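/- Assume ZFC and let A be a set of ordinals. Let ℙ be the Vopěnka forcing whose conditions are (ordinal codes for) nonempty OD_∅ sets of sets of ordinals of the relevant type, ordered by inclusion, and let G_A be the filter of conditions whose decoded set contains A. Then G_A is (HOD,ℙ)-generic and HOD[G_A] = HOD_A, the class of sets hereditarily ordinal-definable from A. -/

import Mathlib

open ZFSet

/-- A class of sets. -/
abbrev ZClass := Set ZFSet

/-- A class is transitive. -/
def ClassTransitive (N : ZClass) : Prop := ∀ x ∈ N, ∀ y : ZFSet, y ∈ x → y ∈ N

/-- A set is a (von Neumann) ordinal: transitive set of transitive sets. -/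
def ZOrd (x : ZFSet) : Prop := x.IsTransitive ∧ ∀ y ∈ x, ZFSet.IsTransitive y

/-- First-order formulas in the language of set theory (variables are natural numbers). -/
inductive Fml : Type
  | mem : ℕ → ℕ → Fml
  | eq : ℕ → ℕ → Fml
  | impl : Fml → Fml → Fml
  | not : Fml → Fml
  | all : ℕ → Fml → Fml

/-- Satisfaction of a formula in a class `N` (with `∈` the real membership),
quantifiers relativized to `N`. -/
def FmlSat (N : ZClass) : Fml → (ℕ → ZFSet) → Prop
  | .mem i j, v => v i ∈ v j
  | .eq i j, v => v i = v j
  | .impl φ ψ, v => FmlSat N φ v → FmlSat N ψ v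
  | .not φ, v => ¬ FmlSat N φ v
  | .all n φ, v => ∀ x ∈ N, FmlSat N φ (Function.update v n x)

/-- `r` (a set of Kuratowski pairs) well-orders the set `x`. -/
def WellOrders (r x : ZFSet) : Prop :=
  (∀ a ∈ x, ∀ b ∈ x, a = b ∨ ZFSet.pair a b ∈ r ∨ ZFSet.pair b a ∈ r) ∧
  (∀ y : ZFSet, y ⊆ x → y ≠ ∅ → ∃ a, a ∈ y ∧ ∀ b ∈ y, a = b ∨ ZFSet.pair a b ∈ r)

/-- `N` is a (transitive-class) model of ZFC: closure under the ZFC axioms,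
with separation and replacement as first-order schemas (relativized to `N`)
and choice in the guise of the wellordering principle. -/
structure ModelsZFC (N : ZClass) : Prop where
  empty_mem : (∅ : ZFSet) ∈ N
  omega_mem : ZFSet.omega ∈ N
  pair_mem : ∀ x ∈ N, ∀ y ∈ N, ({x, y} : ZFSet) ∈ N
  union_mem : ∀ x ∈ N, ZFSet.sUnion x ∈ N
  power_mem : ∀ x ∈ N, ZFSet.sep (fun y => y ∈ N) (ZFSet.powerset x) ∈ N
  sep_mem : ∀ (φ : Fml) (v : ℕ → ZFSet), (∀ n, v n ∈ N) → ∀ x ∈ N,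
      ZFSet.sep (fun y => FmlSat N φ (Function.update v 0 y)) x ∈ N
  repl_mem : ∀ (φ : Fml) (v : ℕ → ZFSet), (∀ n, v n ∈ N) → ∀ x ∈ N,
      ∃ z ∈ N, ∀ b : ZFSet, b ∈ z ↔
        (b ∈ N ∧ ∃ a : ZFSet, a ∈ x ∧
          FmlSat N φ (Function.update (Function.update v 0 a) 1 b) ∧
          ∀ b' ∈ N, FmlSat N φ (Function.update (Function.update v 0 a) 1 b') → b' = b)
  choice_wo : ∀ x ∈ N, ∃ r ∈ N, WellOrders r x

/-- `le` is (the graph of) a partial order on (the members of) `P`. -/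
structure ZPoset (P le : ZFSet) : Prop where
  rel : ∀ z ∈ le, ∃ p, p ∈ P ∧ ∃ q, q ∈ P ∧ z = ZFSet.pair p q
  refl : ∀ p ∈ P, ZFSet.pair p p ∈ le
  antisymm : ∀ p q : ZFSet, ZFSet.pair p q ∈ le → ZFSet.pair q p ∈ le → p = q
  trans : ∀ p q r : ZFSet, ZFSet.pair p q ∈ le → ZFSet.pair q r ∈ le → ZFSet.pair p r ∈ le

/-- `G` is a filter on the poset `(P, le)`. -/
def ZFilter (P le : ZFSet) (G : Set ZFSet) : Prop :=
  (∀ p ∈ G, p ∈ P) ∧ G.Nonempty ∧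
  (∀ p ∈ G, ∀ q : ZFSet, q ∈ P → ZFSet.pair p q ∈ le → q ∈ G) ∧
  (∀ p ∈ G, ∀ q ∈ G, ∃ r ∈ G, ZFSet.pair r p ∈ le ∧ ZFSet.pair r q ∈ le)

/-- `D` is a dense subset of the poset `(P, le)`. -/
def ZDense (P le D : ZFSet) : Prop :=
  D ⊆ P ∧ ∀ p ∈ P, ∃ q, q ∈ D ∧ ZFSet.pair q p ∈ le

/-- `G` is an `(N, P)`-generic filter: it meets every dense subset of `P` lying in `N`. -/
def ZGeneric (N : ZClass) (P le : ZFSet) (G : Set ZFSet) : Prop :=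
  ZFilter P le G ∧ ∀ D ∈ N, ZDense P le D → ∃ p ∈ G, p ∈ D

/-- The set `g` codes the (sub)class `G`. -/
def Codes (g : ZFSet) (G : Set ZFSet) : Prop := ∀ p : ZFSet, p ∈ g ↔ p ∈ G

/-- `NG` is the generic extension `N[G]`: the least transitive ZFC class model
containing `N` and (a set coding) `G`. -/
def IsGenericExt (N : ZClass) (G : Set ZFSet) (NG : ZClass) : Prop :=
  ClassTransitive NG ∧ ModelsZFC NG ∧ N ⊆ NG ∧ (∃ g ∈ NG, Codes g G) ∧
  ∀ N' : ZClass, ClassTransitive N' → ModelsZFC N' → N ⊆ N' → (∃ g ∈ N', Codes g G) → NG ⊆ N'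

/-- `f` is (the graph of) a surjection from `a` onto `b`. -/
def ZSurj (a b f : ZFSet) : Prop :=
  ZFSet.IsFunc a b f ∧ ∀ y ∈ b, ∃ x, x ∈ a ∧ ZFSet.pair x y ∈ f

/-- `x` is ordinal definable: some formula with ordinal parameters defines `{x}` in `V`. -/
def ZOD (x : ZFSet) : Prop :=
  ∃ (φ : Fml) (v : ℕ → ZFSet), (∀ n, ZOrd (v n)) ∧
    ∀ y : ZFSet, FmlSat Set.univ φ (Function.update v 0 y) ↔ y = x

/-- `x` is hereditarily ordinal definable. -/
inductive InHOD : ZFSet → Prop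
  | mk (x : ZFSet) : ZOD x → (∀ y ∈ x, InHOD y) → InHOD x

/-- The class HOD of hereditarily ordinal definable sets. -/
def HODc : ZClass := {x | InHOD x}

/-- `x` is ordinal definable from the parameter `a`. -/
def ZODp (a x : ZFSet) : Prop :=
  ∃ (φ : Fml) (v : ℕ → ZFSet), (∀ n, ZOrd (v n) ∨ v n = a) ∧
    ∀ y : ZFSet, FmlSat Set.univ φ (Function.update v 0 y) ↔ y = x

/-- `x` is hereditarily ordinal definable from the parameter `a`. -/
inductive InHODp (a : ZFSet) : ZFSet → Prop
  | mk (x : ZFSet) : ZODp a x → (∀ y ∈ x, InHODp a y) → InHODp a x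

/-- A Vopěnka condition relative to the ordinal `η`: a nonempty OD set of subsets
of `η`. -/
def VCond (η B : ZFSet) : Prop := ZOD B ∧ B ≠ ∅ ∧ B ⊆ ZFSet.powerset η

/-- The map `c` is ordinal definable (as a class function) on the domain `Dom`. -/
def ODMap (c : ZFSet → ZFSet) (Dom : Set ZFSet) : Prop :=
  ∃ (φ : Fml) (v : ℕ → ZFSet), (∀ n, ZOrd (v n)) ∧
    ∀ B ∈ Dom, ∀ y : ZFSet,
      FmlSat Set.univ φ (Function.update (Function.update v 0 B) 1 y) ↔ y = c B

universe u

namespace Fml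

/-- A strict upper bound for all variables occurring in a formula. -/
def varBound : Fml → ℕ
  | .mem i j => max i j + 1
  | .eq i j => max i j + 1
  | .impl φ ψ => max φ.varBound ψ.varBound
  | .not φ => φ.varBound
  | .all n φ => max (n + 1) φ.varBound

end Fml

theorem FmlSat.congr {N : ZClass.{u}} {φ : Fml} {v w : ℕ → ZFSet.{u}}
    (h : ∀ n < φ.varBound, v n = w n) : FmlSat N φ v ↔ FmlSat N φ w := by
  induction φ generalizing v w with
  | mem i j | eq i j =>
    simp only [FmlSat]
    rw [h i (by simp [Fml.varBound]), h j (by simp [Fml.varBound])]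
  | impl φ ψ ih₁ ih₂ =>
    simp only [FmlSat]
    rw [ih₁ fun n hn => h n (lt_of_lt_of_le hn (le_max_left _ _)),
      ih₂ fun n hn => h n (lt_of_lt_of_le hn (le_max_right _ _))]
  | not φ ih =>
    simp only [FmlSat]
    rw [ih h]
  | all n φ ih =>
    simp only [FmlSat]
    refine forall₂_congr fun x _ => ih fun k hk => ?_
    by_cases hkn : k = n
    · simp [hkn]
    · simpa [hkn] using h k (lt_of_lt_of_le hk (le_max_right _ _))

/-- Every formula can be transformed by an arbitrary substitution of variables for variables. -/
theorem Fml.exists_subst (φ : Fml) (σ : ℕ → ℕ) :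
    ∃ ψ : Fml, ∀ (N : ZClass.{u}) (v : ℕ → ZFSet.{u}), FmlSat N ψ v ↔ FmlSat N φ (v ∘ σ) := by
  induction φ generalizing σ with
  | mem i j => exact ⟨.mem (σ i) (σ j), fun N v => Iff.rfl⟩
  | eq i j => exact ⟨.eq (σ i) (σ j), fun N v => Iff.rfl⟩
  | impl φ ψ ih₁ ih₂ =>
    obtain ⟨φ', h₁⟩ := ih₁ σ
    obtain ⟨ψ', h₂⟩ := ih₂ σ
    exact ⟨.impl φ' ψ', fun N v => by simp only [FmlSat, h₁, h₂]⟩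
  | not φ ih =>
    obtain ⟨φ', h⟩ := ih σ
    exact ⟨.not φ', fun N v => by simp only [FmlSat, h]⟩
  | all n φ ih =>
    obtain ⟨m, hm⟩ : ∃ m, ∀ k < φ.varBound, σ k < m :=
      ⟨(Finset.range φ.varBound).sup σ + 1, fun k hk =>
        Nat.lt_succ_of_le (Finset.le_sup (f := σ) (Finset.mem_range.2 hk))⟩
    obtain ⟨φ', h⟩ := ih (Function.update σ n m)
    refine ⟨.all m φ', fun N v => ?_⟩
    simp only [FmlSat, h]
    refine forall₂_congr fun x _ => FmlSat.congr fun k hk => ?_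
    by_cases hkn : k = n
    · simp [hkn]
    · simp [hkn, (hm k hk).ne]

section Definability

variable {X Y : Type (u + 1)}

/-- `R` is first-order definable over the class `N`, where the values of the functions in `K`
may be used. -/
def Dfn (N : ZClass.{u}) (K : Set (X → ZFSet.{u})) (R : X → Prop) : Prop :=
  ∃ (φ : Fml) (w : ℕ → X → ZFSet.{u}), (∀ n, w n ∈ K ∨ w n = fun _ => ∅) ∧
    ∀ x, FmlSat N φ (fun n => w n x) ↔ R x

/-- Extension of a context by one new variable. -/
def extend (K : Set (X → ZFSet.{u})) : Set (X × ZFSet.{u} → ZFSet.{u}) :=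
  {f | f = Prod.snd ∨ ∃ k ∈ K, f = k ∘ Prod.fst}

namespace Dfn

variable {N : ZClass.{u}} {K : Set (X → ZFSet.{u})} {R S : X → Prop}

theorem congr (h : Dfn N K R) (hRS : ∀ x, R x ↔ S x) : Dfn N K S := by
  obtain ⟨φ, w, hw, hφ⟩ := h
  exact ⟨φ, w, hw, fun x => (hφ x).trans (hRS x)⟩

theorem pullback {L : Set (Y → ZFSet.{u})} (h : Dfn N K R) (g : Y → X)
    (hg : ∀ k ∈ K, k ∘ g ∈ L) : Dfn N L (fun y => R (g y)) := by
  obtain ⟨φ, w, hw, hφ⟩ := h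
  refine ⟨φ, fun n => w n ∘ g, fun n => ?_, fun y => hφ (g y)⟩
  rcases hw n with h | h
  · exact .inl (hg _ h)
  · exact .inr (by simp only [h]; rfl)

theorem mem {a b : X → ZFSet.{u}} (ha : a ∈ K) (hb : b ∈ K) : Dfn N K (fun x => a x ∈ b x) :=
  ⟨.mem 0 1, fun n => if n = 0 then a else b, fun n => by by_cases hn : n = 0 <;> simp [hn, ha, hb],
    fun x => by simp [FmlSat]⟩

theorem eq {a b : X → ZFSet.{u}} (ha : a ∈ K) (hb : b ∈ K) : Dfn N K (fun x => a x = b x) :=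
  ⟨.eq 0 1, fun n => if n = 0 then a else b, fun n => by by_cases hn : n = 0 <;> simp [hn, ha, hb],
    fun x => by simp [FmlSat]⟩

theorem not (h : Dfn N K R) : Dfn N K (fun x => ¬ R x) := by
  obtain ⟨φ, w, hw, hφ⟩ := h
  exact ⟨.not φ, w, hw, fun x => by simp only [FmlSat, hφ]⟩

theorem imp (hR : Dfn N K R) (hS : Dfn N K S) : Dfn N K (fun x => R x → S x) := by
  obtain ⟨φ, w, hw, hφ⟩ := hR
  obtain ⟨ψ, w', hw', hψ⟩ := hS
  obtain ⟨φ', hφ'⟩ := Fml.exists_subst.{u} φ (fun n => 2 * n)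
  obtain ⟨ψ', hψ'⟩ := Fml.exists_subst.{u} ψ (fun n => 2 * n + 1)
  refine ⟨.impl φ' ψ', fun n => if n % 2 = 0 then w (n / 2) else w' (n / 2), fun n => ?_,
    fun x => ?_⟩
  · dsimp only
    split
    · exact hw _
    · exact hw' _
  · change _ ↔ (R x → S x)
    rw [← hφ x, ← hψ x]
    change (FmlSat N φ' _ → FmlSat N ψ' _) ↔ _
    rw [hφ', hψ']
    refine imp_congr (iff_of_eq (congrArg _ (funext fun n => ?_)))
      (iff_of_eq (congrArg _ (funext fun n => ?_)))
    · simp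
    · have h₁ : (2 * n + 1) % 2 = 1 := by omega
      have h₂ : (2 * n + 1) / 2 = n := by omega
      simp [h₁, h₂]

/-- Normal form for relations with a distinguished variable. -/
theorem exists_update {R : X × ZFSet.{u} → Prop} (h : Dfn N (extend K) R) :
    ∃ (φ : Fml) (w : ℕ → X → ZFSet.{u}), (∀ n, w n ∈ K ∨ w n = fun _ => ∅) ∧
      ∀ x y, FmlSat N φ (Function.update (fun n => w n x) 0 y) ↔ R (x, y) := by
  classical
  obtain ⟨φ, w, hw, hφ⟩ := h
  have key : ∀ n, ∃ k : X → ZFSet.{u}, (k ∈ K ∨ k = fun _ => ∅) ∧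
      (w n = Prod.snd ∨ w n = k ∘ Prod.fst) := fun n => by
    rcases hw n with (h | ⟨k, hk, h⟩) | h
    · exact ⟨fun _ => ∅, .inr rfl, .inl h⟩
    · exact ⟨k, .inl hk, .inr h⟩
    · exact ⟨fun _ => ∅, .inr rfl, .inr (by rw [h]; rfl)⟩
  choose k hk hwk using key
  obtain ⟨ψ, hψ⟩ := Fml.exists_subst.{u} φ (fun n => if w n = Prod.snd then 0 else n + 1)
  refine ⟨ψ, fun n => k (n - 1), fun n => hk _, fun x y => ?_⟩
  rw [hψ, ← hφ]
  refine iff_of_eq (congrArg _ (funext fun n => ?_))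
  by_cases h : w n = Prod.snd
  · simp [h]
  · simp [h, congrFun ((hwk n).resolve_left h)]

/-- Normal form for relations with two distinguished variables. -/
theorem exists_update_update {R : (X × ZFSet.{u}) × ZFSet.{u} → Prop}
    (h : Dfn N (extend (extend K)) R) :
    ∃ (φ : Fml) (w : ℕ → X → ZFSet.{u}), (∀ n, w n ∈ K ∨ w n = fun _ => ∅) ∧
      ∀ x y z, FmlSat N φ (Function.update (Function.update (fun n => w n x) 0 y) 1 z) ↔
        R ((x, y), z) := by
  classical
  obtain ⟨φ, w, hw, hφ⟩ := h.exists_update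
  have key : ∀ n, ∃ k : X → ZFSet.{u}, (k ∈ K ∨ k = fun _ => ∅) ∧
      (w n = Prod.snd ∨ w n = k ∘ Prod.fst) := fun n => by
    rcases hw n with (h | ⟨k, hk, h⟩) | h
    · exact ⟨fun _ => ∅, .inr rfl, .inl h⟩
    · exact ⟨k, .inl hk, .inr h⟩
    · exact ⟨fun _ => ∅, .inr rfl, .inr (by rw [h]; rfl)⟩
  choose k hk hwk using key
  obtain ⟨ψ, hψ⟩ := Fml.exists_subst.{u} φ
    (fun n => if n = 0 then 1 else if w n = Prod.snd then 0 else n + 2)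
  refine ⟨ψ, fun n => k (n - 2), fun n => hk _, fun x y z => ?_⟩
  rw [hψ, ← hφ]
  refine iff_of_eq (congrArg _ (funext fun n => ?_))
  by_cases hn : n = 0
  · simp [hn]
  by_cases h : w n = Prod.snd
  · simp [h, hn]
  · simp [h, hn, congrFun ((hwk n).resolve_left h)]

theorem ball {R : X → ZFSet.{u} → Prop} (h : Dfn N (extend K) (fun p => R p.1 p.2)) :
    Dfn N K (fun x => ∀ y ∈ N, R x y) := by
  obtain ⟨φ, w, hw, hφ⟩ := h.exists_update
  exact ⟨.all 0 φ, w, hw, fun x => by simp only [FmlSat, hφ]⟩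

theorem and (hR : Dfn N K R) (hS : Dfn N K S) : Dfn N K (fun x => R x ∧ S x) :=
  (hR.imp hS.not).not.congr fun x => by tauto

theorem or (hR : Dfn N K R) (hS : Dfn N K S) : Dfn N K (fun x => R x ∨ S x) :=
  (hR.not.imp hS).congr fun x => by tauto

theorem iff (hR : Dfn N K R) (hS : Dfn N K S) : Dfn N K (fun x => R x ↔ S x) :=
  ((hR.imp hS).and (hS.imp hR)).congr fun x => by tauto

theorem bex {R : X → ZFSet.{u} → Prop} (h : Dfn N (extend K) (fun p => R p.1 p.2)) :
    Dfn N K (fun x => ∃ y ∈ N, R x y) :=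
  (Dfn.ball (R := fun x y => ¬ R x y) h.not).not.congr fun x => by simp

end Dfn

end Definability

section Contexts

variable {X Y : Type (u + 1)} {K : Set (X → ZFSet.{u})}

/-- `R` is definable over the universe in the context `K`. -/
class DP (K : Set (X → ZFSet.{u})) (R : X → Prop) : Prop where
  out : Dfn Set.univ K R

/-- The graph of `f` is definable over the universe in the context `K`. -/
class DT (K : Set (X → ZFSet.{u})) (f : X → ZFSet.{u}) : Prop where
  out : Dfn Set.univ (extend K) (fun p => p.2 = f p.1)

/-- The map `g` transports the context `K` into the context `L`. -/
class Proj (L : Set (Y → ZFSet.{u})) (K : outParam (Set (X → ZFSet.{u}))) (g : Y → X) :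
    Prop where
  out : ∀ k ∈ K, k ∘ g ∈ L

/-- The empty context. -/
def noCtx : Set (PUnit.{u + 2} → ZFSet.{u}) := ∅

/-- The context with one variable. -/
abbrev Ctx1 := extend noCtx.{u}

/-- The context with two variables. -/
abbrev Ctx2 := extend Ctx1.{u}

/-- The context with three variables. -/
abbrev Ctx3 := extend Ctx2.{u}

/-- The context with four variables. -/
abbrev Ctx4 := extend Ctx3.{u}

theorem DP.congr {R S : X → Prop} (h : DP K R) (e : ∀ x, R x ↔ S x) : DP K S := ⟨h.out.congr e⟩

theorem DP.comp {L : Set (Y → ZFSet.{u})} {R : X → Prop} (h : DP K R) (g : Y → X)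
    (hg : ∀ k ∈ K, k ∘ g ∈ L) : DP L (fun y => R (g y)) := ⟨h.out.pullback g hg⟩

theorem extend_comp {L : Set (Y → ZFSet.{u})} {g : Y → X} (hg : ∀ k ∈ K, k ∘ g ∈ L) :
    ∀ k ∈ extend K, k ∘ (fun p : Y × ZFSet.{u} => (g p.1, p.2)) ∈ extend L := by
  rintro _ (rfl | ⟨k, hk, rfl⟩)
  · exact .inl rfl
  · exact .inr ⟨k ∘ g, hg k hk, rfl⟩

theorem fst_comp_mem_extend : ∀ k ∈ K, k ∘ Prod.fst ∈ extend K := fun k hk => .inr ⟨k, hk, rfl⟩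

theorem DT.comp {L : Set (Y → ZFSet.{u})} {f : X → ZFSet.{u}} (h : DT K f) (g : Y → X)
    (hg : ∀ k ∈ K, k ∘ g ∈ L) : DT L (fun y => f (g y)) :=
  ⟨h.out.pullback (fun p : Y × ZFSet.{u} => (g p.1, p.2)) (extend_comp hg)⟩

instance Proj.id : Proj K K (fun p => p) := ⟨fun _ h => h⟩

instance Proj.fst {L : Set (Y → ZFSet.{u})} {g : Y → X × ZFSet.{u}} [h : Proj L (extend K) g] :
    Proj L K (fun p => (g p).1) := ⟨fun k hk => h.out _ (.inr ⟨k, hk, rfl⟩)⟩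

theorem DT.of_mem_ctx {f : X → ZFSet.{u}} (hf : f ∈ K) : DT K f :=
  ⟨Dfn.eq (a := Prod.snd) (b := f ∘ Prod.fst) (.inl rfl) (.inr ⟨f, hf, rfl⟩)⟩

instance DT.snd {L : Set (Y → ZFSet.{u})} {g : Y → X × ZFSet.{u}} [h : Proj L (extend K) g] :
    DT L (fun p => (g p).2) := DT.of_mem_ctx (h.out _ (.inl rfl))

instance DT.const {a : ZFSet.{u}} [h : DT K (fun _ => a)] : DT (extend K) (fun _ => a) :=
  h.comp Prod.fst fst_comp_mem_extend

variable {R S : X → Prop} {a b c d : X → ZFSet.{u}}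

instance DP.not [h : DP K R] : DP K (fun x => ¬ R x) := ⟨h.out.not⟩
instance DP.imp [h : DP K R] [h' : DP K S] : DP K (fun x => R x → S x) := ⟨h.out.imp h'.out⟩
instance DP.and [h : DP K R] [h' : DP K S] : DP K (fun x => R x ∧ S x) := ⟨h.out.and h'.out⟩
instance DP.or [h : DP K R] [h' : DP K S] : DP K (fun x => R x ∨ S x) := ⟨h.out.or h'.out⟩
instance DP.iff [h : DP K R] [h' : DP K S] : DP K (fun x => R x ↔ S x) := ⟨h.out.iff h'.out⟩

instance DP.all {R : X → ZFSet.{u} → Prop} [h : DP (extend K) (fun p => R p.1 p.2)] :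
    DP K (fun x => ∀ y, R x y) := ⟨h.out.ball.congr fun x => by simp⟩

instance DP.ex {R : X → ZFSet.{u} → Prop} [h : DP (extend K) (fun p => R p.1 p.2)] :
    DP K (fun x => ∃ y, R x y) := ⟨h.out.bex.congr fun x => by simp⟩

/-- Substitution of a term into a relation. -/
theorem DP.subst {R : X → ZFSet.{u} → Prop} (h : DP (extend K) (fun p => R p.1 p.2))
    (ha : DT K a) : DP K (fun x => R x (a x)) :=
  have : DP (extend K) (fun p => p.2 = a p.1) := ⟨ha.out⟩
  (inferInstance : DP K (fun x => ∃ y, y = a x ∧ R x y)).congr fun x => by simp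

theorem DP.app1 {P : ZFSet.{u} → Prop} (h : DP Ctx1 (fun p => P p.2)) (ha : DT K a) :
    DP K (fun x => P (a x)) :=
  DP.subst (R := fun _ y => P y)
    (h.comp (fun p : _ × ZFSet.{u} => (PUnit.unit, p.2))
      (by rintro _ (rfl | ⟨k, hk, -⟩); exacts [.inl rfl, hk.elim])) ha

theorem DP.app2 {P : ZFSet.{u} → ZFSet.{u} → Prop} (h : DP Ctx2 (fun p => P p.1.2 p.2))
    (ha : DT K a) (hb : DT K b) : DP K (fun x => P (a x) (b x)) := by
  refine DP.subst (R := fun x y => P y (b x)) ?_ ha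
  refine DP.subst (R := fun p y => P p.2 y) ?_ (hb.comp Prod.fst fst_comp_mem_extend)
  refine h.comp (fun p : (_ × ZFSet.{u}) × ZFSet.{u} => ((PUnit.unit, p.1.2), p.2)) ?_
  rintro _ (rfl | ⟨_, rfl | ⟨k, hk, -⟩, rfl⟩)
  exacts [.inl rfl, .inr ⟨_, .inl rfl, rfl⟩, hk.elim]

theorem DP.app3 {P : ZFSet.{u} → ZFSet.{u} → ZFSet.{u} → Prop}
    (h : DP Ctx3 (fun p => P p.1.1.2 p.1.2 p.2))
    (ha : DT K a) (hb : DT K b) (hc : DT K c) : DP K (fun x => P (a x) (b x) (c x)) := by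
  refine DP.subst (R := fun x y => P y (b x) (c x)) ?_ ha
  refine DP.subst (R := fun p y => P p.2 y (c p.1)) ?_ (hb.comp Prod.fst fst_comp_mem_extend)
  refine DP.subst (R := fun p y => P p.1.2 p.2 y) ?_
    ((hc.comp Prod.fst fst_comp_mem_extend).comp Prod.fst fst_comp_mem_extend)
  refine h.comp (fun p : ((_ × ZFSet.{u}) × ZFSet.{u}) × ZFSet.{u} =>
    (((PUnit.unit, p.1.1.2), p.1.2), p.2)) ?_
  rintro _ (rfl | ⟨_, rfl | ⟨_, rfl | ⟨k, hk, -⟩, rfl⟩, rfl⟩)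
  exacts [.inl rfl, .inr ⟨_, .inl rfl, rfl⟩, .inr ⟨_, .inr ⟨_, .inl rfl, rfl⟩, rfl⟩, hk.elim]

theorem DP.app4 {P : ZFSet.{u} → ZFSet.{u} → ZFSet.{u} → ZFSet.{u} → Prop}
    (h : DP Ctx4 (fun p => P p.1.1.1.2 p.1.1.2 p.1.2 p.2))
    (ha : DT K a) (hb : DT K b) (hc : DT K c) (hd : DT K d) :
    DP K (fun x => P (a x) (b x) (c x) (d x)) := by
  refine DP.subst (R := fun x y => P y (b x) (c x) (d x)) ?_ ha
  refine DP.subst (R := fun p y => P p.2 y (c p.1) (d p.1)) ?_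
    (hb.comp Prod.fst fst_comp_mem_extend)
  refine DP.subst (R := fun p y => P p.1.2 p.2 y (d p.1.1)) ?_
    ((hc.comp Prod.fst fst_comp_mem_extend).comp Prod.fst fst_comp_mem_extend)
  refine DP.subst (R := fun p y => P p.1.1.2 p.1.2 p.2 y) ?_
    (((hd.comp Prod.fst fst_comp_mem_extend).comp Prod.fst fst_comp_mem_extend).comp Prod.fst
      fst_comp_mem_extend)
  refine h.comp (fun p : (((_ × ZFSet.{u}) × ZFSet.{u}) × ZFSet.{u}) × ZFSet.{u} =>
    ((((PUnit.unit, p.1.1.1.2), p.1.1.2), p.1.2), p.2)) ?_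
  rintro _ (rfl | ⟨_, rfl | ⟨_, rfl | ⟨_, rfl | ⟨k, hk, -⟩, rfl⟩, rfl⟩, rfl⟩)
  exacts [.inl rfl, .inr ⟨_, .inl rfl, rfl⟩, .inr ⟨_, .inr ⟨_, .inl rfl, rfl⟩, rfl⟩,
    .inr ⟨_, .inr ⟨_, .inr ⟨_, .inl rfl, rfl⟩, rfl⟩, rfl⟩, hk.elim]

instance DP.mem [ha : DT K a] [hb : DT K b] : DP K (fun x => a x ∈ b x) :=
  DP.app2 (P := fun y z => y ∈ z) ⟨Dfn.mem (a := fun p : (_ × ZFSet.{u}) × ZFSet.{u} => p.1.2)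
    (b := fun p => p.2)
    (.inr ⟨_, .inl rfl, rfl⟩) (.inl rfl)⟩ ha hb

instance DP.eq [ha : DT K a] [hb : DT K b] : DP K (fun x => a x = b x) :=
  DP.app2 (P := fun y z => y = z) ⟨Dfn.eq (a := fun p : (_ × ZFSet.{u}) × ZFSet.{u} => p.1.2)
    (b := fun p => p.2)
    (.inr ⟨_, .inl rfl, rfl⟩) (.inl rfl)⟩ ha hb

instance DP.ne [ha : DT K a] [hb : DT K b] : DP K (fun x => a x ≠ b x) :=
  (inferInstance : DP K (fun x => ¬ a x = b x))

theorem DT.of_graph {f : X → ZFSet.{u}} (h : DP (extend K) (fun p => p.2 = f p.1)) : DT K f :=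
  ⟨h.out⟩

theorem DT.graph {f : X → ZFSet.{u}} (h : DT K f) : DP (extend K) (fun p => p.2 = f p.1) :=
  ⟨h.out⟩

theorem DT.of_mem {f : X → ZFSet.{u}} {R : X → ZFSet.{u} → Prop}
    (h : DP (extend K) (fun p => R p.1 p.2)) (e : ∀ x z, z ∈ f x ↔ R x z) : DT K f := by
  refine DT.of_graph ?_
  have h' : DP (extend (extend K)) (fun p => R p.1.1 p.2) :=
    h.comp (fun p : (_ × ZFSet.{u}) × ZFSet.{u} => (p.1.1, p.2)) (extend_comp fst_comp_mem_extend)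
  refine (inferInstance : DP (extend K) (fun p => ∀ z, z ∈ p.2 ↔ R p.1 z)).congr fun p => ?_
  simp only [ZFSet.ext_iff, e]

theorem DT.app1 {F : ZFSet.{u} → ZFSet.{u}} (h : DT Ctx1 (fun p => F p.2)) (ha : DT K a) :
    DT K (fun x => F (a x)) :=
  DT.of_graph (DP.app2 (P := fun y z => z = F y) h.graph
    (ha.comp Prod.fst fst_comp_mem_extend) inferInstance)

theorem DT.app2 {F : ZFSet.{u} → ZFSet.{u} → ZFSet.{u}} (h : DT Ctx2 (fun p => F p.1.2 p.2))
    (ha : DT K a) (hb : DT K b) : DT K (fun x => F (a x) (b x)) :=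
  DT.of_graph (DP.app3 (P := fun y z w => w = F y z) h.graph
    (ha.comp Prod.fst fst_comp_mem_extend) (hb.comp Prod.fst fst_comp_mem_extend) inferInstance)

theorem DT.app3 {F : ZFSet.{u} → ZFSet.{u} → ZFSet.{u} → ZFSet.{u}}
    (h : DT Ctx3 (fun p => F p.1.1.2 p.1.2 p.2))
    (ha : DT K a) (hb : DT K b) (hc : DT K c) : DT K (fun x => F (a x) (b x) (c x)) :=
  DT.of_graph (DP.app4 (P := fun y z w t => t = F y z w) h.graph
    (ha.comp Prod.fst fst_comp_mem_extend) (hb.comp Prod.fst fst_comp_mem_extend)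
    (hc.comp Prod.fst fst_comp_mem_extend) inferInstance)

instance DT.empty : DT K (fun _ => ∅) :=
  DT.of_mem (R := fun _ z => z ≠ z) inferInstance (by simp)

end Contexts

section Basic

variable {X : Type (u + 1)} {K : Set (X → ZFSet.{u})} {a b c d : X → ZFSet.{u}}

instance DP.subset [ha : DT K a] [hb : DT K b] : DP K (fun x => a x ⊆ b x) :=
  DP.app2 (P := fun y z => ∀ w, w ∈ y → w ∈ z) inferInstance ha hb

instance DT.insert [ha : DT K a] [hb : DT K b] : DT K (fun x => insert (a x) (b x)) :=
  DT.app2 (DT.of_mem (R := fun p z => z = p.1.2 ∨ z ∈ p.2) inferInstance (by simp)) ha hb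

instance DT.pair [ha : DT K a] [hb : DT K b] : DT K (fun x => pair (a x) (b x)) :=
  (inferInstance : DT K (fun x => {{a x}, {a x, b x}}))

instance DT.union [ha : DT K a] [hb : DT K b] : DT K (fun x => a x ∪ b x) :=
  DT.app2 (DT.of_mem (R := fun p z => z ∈ p.1.2 ∨ z ∈ p.2) inferInstance (by simp)) ha hb

instance DT.sUnion [ha : DT K a] : DT K (fun x => sUnion (a x)) :=
  DT.app1 (DT.of_mem (R := fun p z => ∃ y, y ∈ p.2 ∧ z ∈ y) inferInstance (by simp)) ha

instance DT.powerset [ha : DT K a] : DT K (fun x => powerset (a x)) :=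
  DT.app1 (DT.of_mem (R := fun p z => z ⊆ p.2) inferInstance (by simp)) ha

instance DT.prod [ha : DT K a] [hb : DT K b] : DT K (fun x => prod (a x) (b x)) :=
  DT.app2 (DT.of_mem (R := fun p z => ∃ s, s ∈ p.1.2 ∧ ∃ t, t ∈ p.2 ∧ z = ZFSet.pair s t)
    inferInstance (by simp)) ha hb

instance DP.isTransitive [ha : DT K a] : DP K (fun x => (a x).IsTransitive) :=
  DP.app1 (P := fun y => ∀ w, w ∈ y → w ⊆ y) inferInstance ha

instance DP.zord [ha : DT K a] : DP K (fun x => ZOrd (a x)) :=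
  DP.app1 (P := fun y => y.IsTransitive ∧ ∀ w, w ∈ y → w.IsTransitive) inferInstance ha

end Basic

section Recursion

variable {X : Type (u + 1)} {K : Set (X → ZFSet.{u})} {a b c d : X → ZFSet.{u}}

instance DT.sep {R : X → ZFSet.{u} → Prop} [h : DP (extend K) (fun p => R p.1 p.2)]
    [ha : DT K a] : DT K (fun x => ZFSet.sep (R x) (a x)) :=
  have := ha.comp Prod.fst fst_comp_mem_extend
  DT.of_mem (R := fun x z => z ∈ a x ∧ R x z) inferInstance (by simp)

/-- The graph of the class function `F` restricted to the set `s`. -/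
noncomputable def graphOn (F : ZFSet.{u} → ZFSet.{u}) (s : ZFSet.{u}) : ZFSet.{u} :=
  ZFSet.range (fun c : Shrink.{u} {c // c ∈ s} =>
    ZFSet.pair ((equivShrink _).symm c).1 (F ((equivShrink _).symm c).1))

theorem mem_graphOn {F : ZFSet.{u} → ZFSet.{u}} {s z : ZFSet.{u}} :
    z ∈ graphOn F s ↔ ∃ c ∈ s, z = ZFSet.pair c (F c) := by
  simp only [graphOn, ZFSet.mem_range]
  constructor
  · rintro ⟨c, rfl⟩
    exact ⟨_, ((equivShrink _).symm c).2, rfl⟩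
  · rintro ⟨c, hc, rfl⟩
    exact ⟨equivShrink _ ⟨c, hc⟩, by simp⟩

theorem pair_mem_graphOn {F : ZFSet.{u} → ZFSet.{u}} {s c d : ZFSet.{u}} :
    ZFSet.pair c d ∈ graphOn F s ↔ c ∈ s ∧ d = F c := by
  simp only [mem_graphOn, pair_inj]
  constructor
  · rintro ⟨_, h, rfl, rfl⟩
    exact ⟨h, rfl⟩
  · rintro ⟨h, rfl⟩
    exact ⟨_, h, rfl, rfl⟩

/-- Replacement: the image of a set under a class function. -/
theorem exists_image (F : ZFSet.{u} → ZFSet.{u}) (s : ZFSet.{u}) :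
    ∃ t : ZFSet.{u}, ∀ z, z ∈ t ↔ ∃ c ∈ s, z = F c := by
  refine ⟨ZFSet.range (fun c : Shrink.{u} {c // c ∈ s} => F ((equivShrink _).symm c).1),
    fun z => ?_⟩
  simp only [ZFSet.mem_range]
  constructor
  · rintro ⟨c, rfl⟩
    exact ⟨_, ((equivShrink _).symm c).2, rfl⟩
  · rintro ⟨c, hc, rfl⟩
    exact ⟨equivShrink _ ⟨c, hc⟩, by simp⟩

theorem exists_closed {pd : ZFSet.{u} → ZFSet.{u}} (wf : WellFounded fun y x => y ∈ pd x)
    (x : ZFSet.{u}) : ∃ t : ZFSet.{u}, x ∈ t ∧ ∀ c ∈ t, pd c ⊆ t := by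
  induction x using wf.induction with
  | _ x ih =>
    choose! T hT hT' using ih
    obtain ⟨s, hs⟩ := exists_image T (pd x)
    refine ⟨insert x (ZFSet.sUnion s), by simp, fun c hc z hz => ?_⟩
    simp only [mem_insert_iff, mem_sUnion, hs] at hc ⊢
    rcases hc with rfl | ⟨_, ⟨c', hc', rfl⟩, hc⟩
    · exact .inr ⟨_, ⟨z, hz, rfl⟩, hT z hz⟩
    · exact .inr ⟨_, ⟨c', hc', rfl⟩, hT' c' hc' c hc hz⟩

/-- Functions defined by well-founded recursion from definable data are definable. -/
theorem DT.recursion {F : ZFSet.{u} → ZFSet.{u} → ZFSet.{u}} {pd : ZFSet.{u} → ZFSet.{u}}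
    (hpd : DT Ctx1 (fun p => pd p.2)) (wf : WellFounded fun y x => y ∈ pd x)
    (Γ : ZFSet.{u} → ZFSet.{u} → ZFSet.{u} → ZFSet.{u} → Prop)
    (hΓ : DP Ctx4 (fun p => Γ p.1.1.1.2 p.1.1.2 p.1.2 p.2))
    (e : ∀ v x y, y = F v x ↔ Γ v x (graphOn (F v) (pd x)) y) :
    DT Ctx2 (fun p => F p.1.2 p.2) := by
  have i₁ : ∀ {X : Type (u + 1)} {K : Set (X → ZFSet.{u})} {a : X → ZFSet.{u}} [DT K a],
      DT K (fun x => pd (a x)) := hpd.app1 inferInstance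
  have i₂ : ∀ {X : Type (u + 1)} {K : Set (X → ZFSet.{u})} {a b c d : X → ZFSet.{u}}
      [DT K a] [DT K b] [DT K c] [DT K d], DP K (fun x => Γ (a x) (b x) (c x) (d x)) :=
    hΓ.app4 inferInstance inferInstance inferInstance inferInstance
  let C : ZFSet.{u} → ZFSet.{u} → Prop := fun v f => ∀ z ∈ f, ∃ a b, z = ZFSet.pair a b ∧
      (∀ c ∈ pd a, ∃ d, ZFSet.pair c d ∈ f) ∧
      Γ v a (ZFSet.sep (fun w => ∃ c ∈ pd a, ∃ d, w = ZFSet.pair c d) f) b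
  have hC : DP Ctx2 (fun p => C p.1.2 p.2) := by
    simp only [C]
    infer_instance
  have correct : ∀ v f, C v f → ∀ a b, ZFSet.pair a b ∈ f → b = F v a := by
    intro v f hf a
    induction a using wf.induction with
    | _ a ih =>
      intro b hab
      obtain ⟨a', b', h, h₁, h₂⟩ := hf _ hab
      obtain ⟨rfl, rfl⟩ := pair_inj.1 h
      rw [e]
      convert h₂ using 1
      ext w
      simp only [mem_graphOn, mem_sep]
      constructor
      · rintro ⟨c, hc, rfl⟩
        obtain ⟨d, hd⟩ := h₁ c hc
        rw [← ih c hc d hd]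
        exact ⟨hd, c, hc, d, rfl⟩
      · rintro ⟨hw, c, hc, d, rfl⟩
        exact ⟨c, hc, by rw [ih c hc d hw]⟩
  have i₃ : ∀ {X : Type (u + 1)} {K : Set (X → ZFSet.{u})} {a b : X → ZFSet.{u}}
      [DT K a] [DT K b], DP K (fun x => C (a x) (b x)) := hC.app2 inferInstance inferInstance
  refine DT.of_graph ((inferInstance : DP Ctx3 (fun p => ∃ f, ZFSet.pair p.1.2 p.2 ∈ f ∧
    C p.1.1.2 f)).congr fun p => ⟨fun ⟨f, hf, hC⟩ => correct _ _ hC _ _ hf, fun h => ?_⟩)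
  obtain ⟨t, hxt, ht⟩ := exists_closed wf p.1.2
  refine ⟨graphOn (F p.1.1.2) t, by rw [pair_mem_graphOn]; exact ⟨hxt, h⟩, fun z hz => ?_⟩
  obtain ⟨a, ha, rfl⟩ := mem_graphOn.1 hz
  refine ⟨a, _, rfl, fun c hc => ⟨_, pair_mem_graphOn.2 ⟨ht a ha hc, rfl⟩⟩, ?_⟩
  have := (e p.1.1.2 a _).1 rfl
  convert this using 1
  ext w
  simp only [mem_graphOn, mem_sep]
  constructor
  · rintro ⟨⟨c, _, rfl⟩, c', hc', d, h⟩
    obtain ⟨rfl, rfl⟩ := pair_inj.1 h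
    exact ⟨c, hc', rfl⟩
  · rintro ⟨c, hc, rfl⟩
    exact ⟨⟨c, ht a ha hc, rfl⟩, c, hc, _, rfl⟩

end Recursion

section Ordinals

theorem zord_iff {x : ZFSet.{u}} : ZOrd x ↔ x.IsOrdinal :=
  isOrdinal_iff_forall_mem_isTransitive.symm

theorem zord_toZFSet (o : Ordinal.{u}) : ZOrd o.toZFSet := zord_iff.2 (isOrdinal_toZFSet o)

theorem ZOrd.exists_eq {x : ZFSet.{u}} (h : ZOrd x) : ∃ o : Ordinal.{u}, x = o.toZFSet :=
  ⟨_, (zord_iff.1 h).toZFSet_rank_eq.symm⟩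

theorem ZOrd.mem {x y : ZFSet.{u}} (h : ZOrd x) (hy : y ∈ x) : ZOrd y :=
  zord_iff.2 ((zord_iff.1 h).mem hy)

theorem zord_empty : ZOrd (∅ : ZFSet.{u}) := zord_iff.2 isOrdinal_empty

theorem toZFSet_union (α β : Ordinal.{u}) :
    α.toZFSet ∪ β.toZFSet = (max α β).toZFSet := by
  ext z
  simp only [mem_union, Ordinal.mem_toZFSet_iff, lt_max_iff]
  grind

end Ordinals

section Hierarchy

/-- The level of the cumulative hierarchy indexed by the rank of `x`. -/
noncomputable def Vz (x : ZFSet.{u}) : ZFSet.{u} := vonNeumann (rank x)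

theorem mem_Vz {x z : ZFSet.{u}} : z ∈ Vz x ↔ ∃ y ∈ x, z ⊆ Vz y := by
  simp only [Vz, mem_vonNeumann, lt_rank_iff, subset_vonNeumann]

variable {X : Type (u + 1)} {K : Set (X → ZFSet.{u})} {a b c d : X → ZFSet.{u}}

instance DT.Vz [ha : DT K a] : DT K (fun x => Vz (a x)) := by
  have h : DT Ctx2.{u} (fun p => _root_.Vz p.2) :=
    DT.recursion (F := fun _ x => _root_.Vz x) (pd := fun x => x) inferInstance mem_wf
      (fun _ _ g y => ∀ z, z ∈ y ↔ ∃ c d, ZFSet.pair c d ∈ g ∧ z ⊆ d) inferInstance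
      (fun v x y => by
        simp only [pair_mem_graphOn, ZFSet.ext_iff (x := y), mem_Vz (x := x)]
        refine forall_congr' fun z => iff_congr Iff.rfl ⟨?_, ?_⟩
        · rintro ⟨c, hc, h⟩
          exact ⟨c, _, ⟨hc, rfl⟩, h⟩
        · rintro ⟨c, _, ⟨hc, rfl⟩, h⟩
          exact ⟨c, hc, h⟩)
  exact DT.app2 (F := fun _ x => _root_.Vz x) h ha ha

end Hierarchy

section Pairing

/-- The canonical ordering of pairs of ordinals: by maximum, then lexicographically. -/
def OrdPairLt (c d a b : ZFSet.{u}) : Prop :=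
  c ∪ d ∈ a ∪ b ∨ c ∪ d = a ∪ b ∧ (c ∈ a ∨ c = a ∧ d ∈ b)

/-- The key by which pairs of ordinals are ordered. -/
noncomputable def ordKey (α β : Ordinal.{u}) : Ordinal.{u} ×ₗ Ordinal.{u} ×ₗ Ordinal.{u} :=
  toLex (max α β, toLex (α, β))

theorem ordPairLt_toZFSet {α β γ δ : Ordinal.{u}} :
    OrdPairLt γ.toZFSet δ.toZFSet α.toZFSet β.toZFSet ↔ ordKey γ δ < ordKey α β := by
  simp only [OrdPairLt, toZFSet_union, Ordinal.toZFSet_mem_toZFSet_iff,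
    Ordinal.toZFSet_injective.eq_iff, ordKey, Prod.Lex.toLex_lt_toLex]

/-- The predecessors of a pair of ordinals in the canonical ordering. -/
noncomputable def ordPred (p : ZFSet.{u}) : ZFSet.{u} :=
  ZFSet.sep (fun q => ∃ a b c d, p = ZFSet.pair a b ∧ ZOrd a ∧ ZOrd b ∧ q = ZFSet.pair c d ∧
    ZOrd c ∧ ZOrd d ∧ OrdPairLt c d a b)
    (ZFSet.prod (insert (⋃₀ ⋃₀ p : ZFSet) (⋃₀ ⋃₀ p)) (insert (⋃₀ ⋃₀ p : ZFSet) (⋃₀ ⋃₀ p)))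

theorem sUnion_sUnion_pair (a b : ZFSet.{u}) : (⋃₀ ⋃₀ (ZFSet.pair a b) : ZFSet) = a ∪ b := by
  ext z
  simp only [ZFSet.pair, mem_sUnion, ZFSet.mem_pair, mem_union]
  constructor
  · rintro ⟨y, ⟨x, rfl | rfl, h⟩, hz⟩ <;> simp at h <;> aesop
  · rintro (h | h)
    · exact ⟨a, ⟨_, .inr rfl, by simp⟩, h⟩
    · exact ⟨b, ⟨_, .inr rfl, by simp⟩, h⟩

theorem mem_ordPred {q : ZFSet.{u}} {α β : Ordinal.{u}} :
    q ∈ ordPred (ZFSet.pair α.toZFSet β.toZFSet) ↔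
      ∃ γ δ : Ordinal.{u}, q = ZFSet.pair γ.toZFSet δ.toZFSet ∧ ordKey γ δ < ordKey α β := by
  simp only [ordPred, mem_sep, sUnion_sUnion_pair, toZFSet_union]
  constructor
  · rintro ⟨-, a, b, c, d, h, ha, hb, rfl, hc, hd, hlt⟩
    obtain ⟨rfl, rfl⟩ := pair_inj.1 h
    obtain ⟨γ, rfl⟩ := hc.exists_eq
    obtain ⟨δ, rfl⟩ := hd.exists_eq
    exact ⟨γ, δ, rfl, ordPairLt_toZFSet.1 hlt⟩
  · rintro ⟨γ, δ, rfl, h⟩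
    refine ⟨?_, _, _, _, _, rfl, zord_toZFSet _, zord_toZFSet _, rfl, zord_toZFSet _,
      zord_toZFSet _, ordPairLt_toZFSet.2 h⟩
    have hm : max γ δ ≤ max α β := by
      rw [ordKey, ordKey, Prod.Lex.toLex_lt_toLex] at h
      exact h.elim le_of_lt fun h => h.1.le
    rw [pair_mem_prod, ← Ordinal.toZFSet_add_one, Ordinal.toZFSet_mem_toZFSet_iff,
      Ordinal.toZFSet_mem_toZFSet_iff, Order.lt_add_one_iff, Order.lt_add_one_iff]
    exact ⟨(le_max_left _ _).trans hm, (le_max_right _ _).trans hm⟩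

theorem exists_of_mem_ordPred {p q : ZFSet.{u}} (h : q ∈ ordPred p) :
    ∃ α β : Ordinal.{u}, p = ZFSet.pair α.toZFSet β.toZFSet := by
  obtain ⟨-, a, b, c, d, rfl, ha, hb, -⟩ := mem_sep.1 h
  obtain ⟨α, rfl⟩ := ha.exists_eq
  obtain ⟨β, rfl⟩ := hb.exists_eq
  exact ⟨α, β, rfl⟩

theorem ordPred_wf : WellFounded fun q p : ZFSet.{u} => q ∈ ordPred p := by
  have key : ∀ (k : Ordinal.{u} ×ₗ Ordinal.{u} ×ₗ Ordinal.{u}) (α β : Ordinal.{u}),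
      ordKey α β = k → Acc (fun q p : ZFSet.{u} => q ∈ ordPred p)
        (ZFSet.pair α.toZFSet β.toZFSet) := by
    intro k
    induction k using WellFoundedLT.induction with
    | _ k ih =>
      rintro α β rfl
      refine ⟨_, fun q hq => ?_⟩
      obtain ⟨γ, δ, rfl, h⟩ := mem_ordPred.1 hq
      exact ih _ h _ _ rfl
  refine ⟨fun p => ⟨_, fun q hq => ?_⟩⟩
  obtain ⟨α, β, rfl⟩ := exists_of_mem_ordPred hq
  obtain ⟨γ, δ, rfl, -⟩ := mem_ordPred.1 hq
  exact key _ _ _ rfl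

/-- The order type of the predecessors of a pair of ordinals. -/
noncomputable def pairRec : ZFSet.{u} → ZFSet.{u} :=
  ordPred_wf.fix fun p F => ZFSet.range (fun q : Shrink.{u} {q // q ∈ ordPred p} =>
    F ((equivShrink _).symm q).1 ((equivShrink _).symm q).2)

theorem mem_pairRec {p z : ZFSet.{u}} : z ∈ pairRec p ↔ ∃ q ∈ ordPred p, z = pairRec q := by
  rw [pairRec, ordPred_wf.fix_eq, ← pairRec]
  simp only [ZFSet.mem_range]
  constructor
  · rintro ⟨c, rfl⟩
    exact ⟨_, ((equivShrink _).symm c).2, rfl⟩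
  · rintro ⟨c, hc, rfl⟩
    exact ⟨equivShrink _ ⟨c, hc⟩, by simp⟩

/-- The canonical pairing of ordinals. -/
noncomputable def J (a b : ZFSet.{u}) : ZFSet.{u} := pairRec (ZFSet.pair a b)

theorem mem_J {z : ZFSet.{u}} {α β : Ordinal.{u}} : z ∈ J α.toZFSet β.toZFSet ↔
    ∃ γ δ : Ordinal.{u}, ordKey γ δ < ordKey α β ∧ z = J γ.toZFSet δ.toZFSet := by
  simp only [J, mem_pairRec, mem_ordPred]
  constructor
  · rintro ⟨_, ⟨γ, δ, rfl, h⟩, rfl⟩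
    exact ⟨γ, δ, h, rfl⟩
  · rintro ⟨γ, δ, h, rfl⟩
    exact ⟨_, ⟨γ, δ, rfl, h⟩, rfl⟩

theorem J_isTransitive (α β : Ordinal.{u}) : (J α.toZFSet β.toZFSet).IsTransitive := by
  intro y hy z hz
  obtain ⟨γ, δ, h, rfl⟩ := mem_J.1 hy
  obtain ⟨γ', δ', h', rfl⟩ := mem_J.1 hz
  exact mem_J.2 ⟨γ', δ', h'.trans h, rfl⟩

theorem ZOrd.J {a b : ZFSet.{u}} (ha : ZOrd a) (hb : ZOrd b) : ZOrd (J a b) := by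
  obtain ⟨α, rfl⟩ := ha.exists_eq
  obtain ⟨β, rfl⟩ := hb.exists_eq
  refine ⟨J_isTransitive _ _, fun y hy => ?_⟩
  obtain ⟨γ, δ, -, rfl⟩ := mem_J.1 hy
  exact J_isTransitive _ _

theorem J_inj {a b c d : ZFSet.{u}} (ha : ZOrd a) (hb : ZOrd b) (hc : ZOrd c) (hd : ZOrd d) :
    J a b = J c d ↔ a = c ∧ b = d := by
  refine ⟨fun h => ?_, fun h => by rw [h.1, h.2]⟩
  obtain ⟨α, rfl⟩ := ha.exists_eq
  obtain ⟨β, rfl⟩ := hb.exists_eq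
  obtain ⟨γ, rfl⟩ := hc.exists_eq
  obtain ⟨δ, rfl⟩ := hd.exists_eq
  rcases lt_trichotomy (ordKey α β) (ordKey γ δ) with hlt | heq | hlt
  · exact (mem_irrefl _ (mem_J.2 ⟨α, β, hlt, h.symm⟩)).elim
  · have h' := congrArg (fun k => ofLex (ofLex k).2) heq
    simp only [ordKey, ofLex_toLex, Prod.mk.injEq] at h'
    rw [h'.1, h'.2]
    exact ⟨rfl, rfl⟩
  · exact (mem_irrefl _ (mem_J.2 ⟨γ, δ, hlt, h⟩)).elim

theorem ordKey_lt_left {α γ : Ordinal.{u}} (β : Ordinal.{u}) (h : γ < α) :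
    ordKey γ β < ordKey α β := by
  rw [ordKey, ordKey, Prod.Lex.toLex_lt_toLex, Prod.Lex.toLex_lt_toLex]
  rcases (max_le_max_right β h.le).lt_or_eq with h' | h'
  · exact .inl h'
  · exact .inr ⟨h', .inl h⟩

theorem ordKey_lt_right {β δ : Ordinal.{u}} (α : Ordinal.{u}) (h : δ < β) :
    ordKey α δ < ordKey α β := by
  rw [ordKey, ordKey, Prod.Lex.toLex_lt_toLex, Prod.Lex.toLex_lt_toLex]
  rcases (max_le_max_left α h.le).lt_or_eq with h' | h'
  · exact .inl h'
  · exact .inr ⟨h', .inr ⟨rfl, h⟩⟩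

theorem left_subset_J {a b : ZFSet.{u}} (ha : ZOrd a) (hb : ZOrd b) : a ⊆ J a b := by
  obtain ⟨α, rfl⟩ := ha.exists_eq
  obtain ⟨β, rfl⟩ := hb.exists_eq
  clear ha hb
  induction α using WellFoundedLT.induction with
  | _ α ih =>
    intro z hz
    obtain ⟨γ, hγ, rfl⟩ := Ordinal.mem_toZFSet_iff.1 hz
    exact (isOrdinal_toZFSet γ).mem_of_subset_of_mem
      (zord_iff.1 ((zord_toZFSet _).J (zord_toZFSet _))) (ih γ hγ)
      (mem_J.2 ⟨γ, β, ordKey_lt_left β hγ, rfl⟩)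

theorem right_subset_J {a b : ZFSet.{u}} (ha : ZOrd a) (hb : ZOrd b) : b ⊆ J a b := by
  obtain ⟨α, rfl⟩ := ha.exists_eq
  obtain ⟨β, rfl⟩ := hb.exists_eq
  clear ha hb
  induction β using WellFoundedLT.induction with
  | _ β ih =>
    intro z hz
    obtain ⟨δ, hδ, rfl⟩ := Ordinal.mem_toZFSet_iff.1 hz
    exact (isOrdinal_toZFSet δ).mem_of_subset_of_mem
      (zord_iff.1 ((zord_toZFSet _).J (zord_toZFSet _))) (ih δ hδ)
      (mem_J.2 ⟨α, δ, ordKey_lt_right α hδ, rfl⟩)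

theorem right_mem_J {a b : ZFSet.{u}} (ha : ZOrd a) (ha0 : a ≠ ∅) (hb : ZOrd b) : b ∈ J a b := by
  obtain ⟨α, rfl⟩ := ha.exists_eq
  obtain ⟨β, rfl⟩ := hb.exists_eq
  have h0 : 0 < α := pos_iff_ne_zero.2 fun h => ha0 (by rw [h, Ordinal.toZFSet_zero])
  refine (isOrdinal_toZFSet β).mem_of_subset_of_mem (zord_iff.1 (ha.J hb))
    (right_subset_J (zord_toZFSet 0) hb) (mem_J.2 ⟨0, β, ordKey_lt_left β h0, rfl⟩)

variable {X : Type (u + 1)} {K : Set (X → ZFSet.{u})} {a b c d : X → ZFSet.{u}}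

instance DP.ordPairLt [ha : DT K a] [hb : DT K b] [hc : DT K c] [hd : DT K d] :
    DP K (fun x => OrdPairLt (a x) (b x) (c x) (d x)) := by
  unfold OrdPairLt
  infer_instance

theorem DT.ordPred : DT Ctx1.{u} (fun p => ordPred p.2) := by
  unfold _root_.ordPred
  infer_instance

instance DT.J [ha : DT K a] [hb : DT K b] : DT K (fun x => J (a x) (b x)) := by
  have h : DT Ctx2.{u} (fun p => pairRec p.2) :=
    DT.recursion (F := fun _ x => pairRec x) DT.ordPred ordPred_wf
      (fun _ _ g y => ∀ z, z ∈ y ↔ ∃ c d, ZFSet.pair c d ∈ g ∧ z = d) inferInstance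
      (fun v x y => by
        simp only [pair_mem_graphOn, ZFSet.ext_iff (x := y), mem_pairRec (p := x)]
        refine forall_congr' fun z => iff_congr Iff.rfl ⟨?_, ?_⟩
        · rintro ⟨c, hc, h⟩
          exact ⟨c, _, ⟨hc, rfl⟩, h⟩
        · rintro ⟨c, _, ⟨hc, rfl⟩, h⟩
          exact ⟨c, hc, h⟩)
  exact DT.app2 (F := fun _ x => pairRec x) h ha inferInstance

end Pairing

section Truth

/-- The finite von Neumann ordinals. -/
noncomputable def num (n : ℕ) : ZFSet.{u} := (n : Ordinal.{u}).toZFSet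

theorem num_inj {m n : ℕ} : num.{u} m = num n ↔ m = n := by
  simp [num, Ordinal.toZFSet_injective.eq_iff]

theorem zord_num (n : ℕ) : ZOrd (num.{u} n) := zord_toZFSet _

theorem num_zero : num.{u} 0 = ∅ := by simp [num]

theorem num_succ (n : ℕ) : num.{u} (n + 1) = insert (num n) (num n) := by
  simp [num, Ordinal.toZFSet_add_one]

/-- The assignment `s` modified to take the value `y` at the variable `n`. -/
noncomputable def upd (s n y : ZFSet.{u}) : ZFSet.{u} :=
  ZFSet.sep (fun z => ¬ ∃ a, z = ZFSet.pair n a) s ∪ {ZFSet.pair n y}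

/-- The clauses of the truth definition for structures `U`, with the additional connective of
substituting an ordinal constant. -/
def TruthClause (U t x s : ZFSet.{u}) (T : ZFSet.{u} → ZFSet.{u} → Prop) : Prop :=
  (t = num 1 ∧ ∃ i j, ZOrd i ∧ ZOrd j ∧ x = J i j ∧
    ∃ a b, ZFSet.pair i a ∈ s ∧ ZFSet.pair j b ∈ s ∧ a ∈ b) ∨
  (t = num 2 ∧ ∃ i j, ZOrd i ∧ ZOrd j ∧ x = J i j ∧
    ∃ a b, ZFSet.pair i a ∈ s ∧ ZFSet.pair j b ∈ s ∧ a = b) ∨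
  (t = num 3 ∧ ∃ f g, ZOrd f ∧ ZOrd g ∧ x = J f g ∧ ¬ (T f s ∧ T g s)) ∨
  (t = num 4 ∧ ∃ n f, ZOrd n ∧ ZOrd f ∧ x = J n f ∧ ∀ y, y ∈ U → T f (upd s n y)) ∨
  (t = num 5 ∧ ∃ n c f, ZOrd n ∧ ZOrd c ∧ ZOrd f ∧ x = J n (J c f) ∧ T f (upd s n c))

/-- The set of assignments over `U` which satisfy the formula with code `f`. -/
noncomputable def Tr (U : ZFSet.{u}) : ZFSet.{u} → ZFSet.{u} :=
  mem_wf.fix fun f T => ZFSet.sep (fun s => ∃ t x, ZOrd t ∧ ZOrd x ∧ f = J t x ∧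
    TruthClause U t x s (fun g s' => ∃ h : g ∈ f, s' ∈ T g h)) (powerset (ZFSet.prod U U))

theorem mem_Tr' {U f s : ZFSet.{u}} : s ∈ Tr U f ↔ s ⊆ ZFSet.prod U U ∧
    ∃ t x, ZOrd t ∧ ZOrd x ∧ f = J t x ∧
      TruthClause U t x s (fun g s' => g ∈ f ∧ s' ∈ Tr U g) := by
  rw [Tr, mem_wf.fix_eq, ← Tr]
  simp only [mem_sep, mem_powerset, exists_prop]

theorem mem_Tr {U x s : ZFSet.{u}} {k : ℕ} (hx : ZOrd x) (hs : s ⊆ ZFSet.prod U U) :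
    s ∈ Tr U (J (num k) x) ↔
      TruthClause U (num k) x s (fun g s' => g ∈ J (num k) x ∧ s' ∈ Tr U g) := by
  rw [mem_Tr']
  constructor
  · rintro ⟨-, t, y, ht, hy, h, hT⟩
    obtain ⟨rfl, rfl⟩ := (J_inj (zord_num k) hx ht hy).1 h
    exact hT
  · exact fun h => ⟨hs, _, _, zord_num k, hx, rfl, h⟩

variable {U s : ZFSet.{u}}

theorem mem_Tr_mem (hs : s ⊆ ZFSet.prod U U) {i j : ZFSet.{u}} (hi : ZOrd i) (hj : ZOrd j) :
    s ∈ Tr U (J (num 1) (J i j)) ↔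
      ∃ a b, ZFSet.pair i a ∈ s ∧ ZFSet.pair j b ∈ s ∧ a ∈ b := by
  rw [mem_Tr (hi.J hj) hs]
  simp only [TruthClause, num_inj, OfNat.one_ne_ofNat, true_and, false_and,
    or_false]
  constructor
  · rintro ⟨i', j', hi', hj', h, H⟩
    obtain ⟨rfl, rfl⟩ := (J_inj hi hj hi' hj').1 h
    exact H
  · exact fun H => ⟨i, j, hi, hj, rfl, H⟩

theorem mem_Tr_eq (hs : s ⊆ ZFSet.prod U U) {i j : ZFSet.{u}} (hi : ZOrd i) (hj : ZOrd j) :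
    s ∈ Tr U (J (num 2) (J i j)) ↔
      ∃ a b, ZFSet.pair i a ∈ s ∧ ZFSet.pair j b ∈ s ∧ a = b := by
  rw [mem_Tr (hi.J hj) hs]
  simp only [TruthClause, num_inj, OfNat.ofNat_ne_one, Nat.reduceEqDiff,
    true_and, false_and, or_false, false_or]
  constructor
  · rintro ⟨i', j', hi', hj', h, H⟩
    obtain ⟨rfl, rfl⟩ := (J_inj hi hj hi' hj').1 h
    exact H
  · exact fun H => ⟨i, j, hi, hj, rfl, H⟩

theorem num_ne_empty (k : ℕ) : num.{u} (k + 1) ≠ ∅ := by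
  rw [← num_zero, Ne, num_inj]
  omega

theorem left_mem_code (k : ℕ) {f g : ZFSet.{u}} (hf : ZOrd f) (hg : ZOrd g) :
    f ∈ J (num (k + 1)) (J f g) :=
  (zord_iff.1 hf).mem_of_subset_of_mem (zord_iff.1 ((zord_num _).J (hf.J hg)))
    (left_subset_J hf hg) (right_mem_J (zord_num _) (num_ne_empty k) (hf.J hg))

theorem right_mem_code (k : ℕ) {f g : ZFSet.{u}} (hf : ZOrd f) (hg : ZOrd g) :
    g ∈ J (num (k + 1)) (J f g) :=
  (zord_iff.1 hg).mem_of_subset_of_mem (zord_iff.1 ((zord_num _).J (hf.J hg)))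
    (right_subset_J hf hg) (right_mem_J (zord_num _) (num_ne_empty k) (hf.J hg))

theorem mem_Tr_nand (hs : s ⊆ ZFSet.prod U U) {f g : ZFSet.{u}} (hf : ZOrd f) (hg : ZOrd g) :
    s ∈ Tr U (J (num 3) (J f g)) ↔ ¬ (s ∈ Tr U f ∧ s ∈ Tr U g) := by
  rw [mem_Tr (hf.J hg) hs]
  simp only [TruthClause, num_inj, OfNat.ofNat_ne_one, Nat.reduceEqDiff,
    true_and, false_and, or_false, false_or]
  have h₁ := left_mem_code 2 hf hg
  have h₂ := right_mem_code 2 hf hg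
  constructor
  · rintro ⟨f', g', hf', hg', h, H⟩
    obtain ⟨rfl, rfl⟩ := (J_inj hf hg hf' hg').1 h
    tauto
  · exact fun H => ⟨f, g, hf, hg, rfl, by tauto⟩

theorem mem_Tr_all (hs : s ⊆ ZFSet.prod U U) {n f : ZFSet.{u}} (hn : ZOrd n) (hf : ZOrd f) :
    s ∈ Tr U (J (num 4) (J n f)) ↔ ∀ y ∈ U, upd s n y ∈ Tr U f := by
  rw [mem_Tr (hn.J hf) hs]
  simp only [TruthClause, num_inj, OfNat.ofNat_ne_one, Nat.reduceEqDiff,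
    true_and, false_and, or_false, false_or]
  constructor
  · rintro ⟨f', g', hf', hg', h, H⟩
    obtain ⟨rfl, rfl⟩ := (J_inj hn hf hf' hg').1 h
    exact fun y hy => (H y hy).2
  · exact fun H => ⟨n, f, hn, hf, rfl, fun y hy => ⟨right_mem_code 3 hn hf, H y hy⟩⟩

theorem mem_Tr_sub (hs : s ⊆ ZFSet.prod U U) {n c f : ZFSet.{u}} (hn : ZOrd n) (hc : ZOrd c)
    (hf : ZOrd f) : s ∈ Tr U (J (num 5) (J n (J c f))) ↔ upd s n c ∈ Tr U f := by
  rw [mem_Tr (hn.J (hc.J hf)) hs]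
  simp only [TruthClause, num_inj, OfNat.ofNat_ne_one, Nat.reduceEqDiff,
    true_and, false_and, false_or]
  constructor
  · rintro ⟨n', c', f', hn', hc', hf', h, H⟩
    obtain ⟨rfl, h'⟩ := (J_inj hn (hc.J hf) hn' (hc'.J hf')).1 h
    obtain ⟨rfl, rfl⟩ := (J_inj hc hf hc' hf').1 h'
    exact H.2
  · exact fun H => ⟨n, c, f, hn, hc, hf, rfl, (zord_iff.1 hf).mem_of_subset_of_mem
      (zord_iff.1 ((zord_num _).J (hn.J (hc.J hf)))) (right_subset_J hc hf)
      (right_mem_code 4 hn (hc.J hf)), H⟩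

/-- The ordinal coding a formula. -/
noncomputable def Fml.code : Fml → ZFSet.{u}
  | .mem i j => J (num 1) (J (num i) (num j))
  | .eq i j => J (num 2) (J (num i) (num j))
  | .impl φ ψ => J (num 3) (J φ.code (J (num 3) (J ψ.code ψ.code)))
  | .not φ => J (num 3) (J φ.code φ.code)
  | .all n φ => J (num 4) (J (num n) φ.code)

theorem Fml.zord_code (φ : Fml) : ZOrd φ.code.{u} := by
  induction φ with
  | mem i j | eq i j => exact (zord_num _).J ((zord_num _).J (zord_num _))
  | impl φ ψ h₁ h₂ => exact (zord_num _).J (h₁.J ((zord_num _).J (h₂.J h₂)))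
  | not φ h => exact (zord_num _).J (h.J h)
  | all n φ h => exact (zord_num _).J ((zord_num _).J h)

/-- The set `s` represents the first `N` values of the assignment `v`. -/
def Represents (s : ZFSet.{u}) (N : ℕ) (v : ℕ → ZFSet.{u}) : Prop :=
  ∀ n < N, ∀ a, ZFSet.pair (num n) a ∈ s ↔ a = v n

theorem Represents.upd {N : ℕ} {v : ℕ → ZFSet.{u}} (h : Represents s N v) (n : ℕ) (y : ZFSet.{u}) :
    Represents (upd s (num n) y) N (Function.update v n y) := by
  intro m hm a
  simp only [_root_.upd, mem_union, mem_sep, pair_inj, num_inj, mem_singleton]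
  by_cases hmn : m = n
  · subst hmn
    simp
  · simp [hmn, h m hm]

theorem upd_subset {N y : ZFSet.{u}} (hs : s ⊆ ZFSet.prod U U) (hN : N ∈ U) (hy : y ∈ U) :
    upd s N y ⊆ ZFSet.prod U U := by
  intro z hz
  simp only [upd, mem_union, mem_sep, mem_singleton] at hz
  rcases hz with h | rfl
  · exact hs h.1
  · exact pair_mem_prod.2 ⟨hN, hy⟩

theorem mem_Tr_code {N : ℕ} {v : ℕ → ZFSet.{u}} {φ : Fml} (hU : ∀ n, num n ∈ U)
    (hs : s ⊆ ZFSet.prod U U) (hv : Represents s N v) (hφ : φ.varBound ≤ N) :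
    s ∈ Tr U φ.code ↔ FmlSat {x | x ∈ U} φ v := by
  induction φ generalizing s v with
  | mem i j =>
    simp only [Fml.varBound] at hφ
    rw [Fml.code, mem_Tr_mem hs (zord_num _) (zord_num _)]
    simp [hv i (by omega), hv j (by omega), FmlSat]
  | eq i j =>
    simp only [Fml.varBound] at hφ
    rw [Fml.code, mem_Tr_eq hs (zord_num _) (zord_num _)]
    simp [hv i (by omega), hv j (by omega), FmlSat]
  | impl φ ψ h₁ h₂ =>
    simp only [Fml.varBound] at hφ
    rw [Fml.code, mem_Tr_nand hs φ.zord_code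
      ((zord_num _).J (ψ.zord_code.J ψ.zord_code)), mem_Tr_nand hs ψ.zord_code ψ.zord_code,
      h₁ hs hv (by omega), h₂ hs hv (by omega)]
    simp only [FmlSat]
    tauto
  | not φ h =>
    rw [Fml.code, mem_Tr_nand hs φ.zord_code φ.zord_code, h hs hv hφ]
    simp only [FmlSat]
    tauto
  | all n φ h =>
    simp only [Fml.varBound] at hφ
    rw [Fml.code, mem_Tr_all hs (zord_num _) φ.zord_code]
    exact forall₂_congr fun y hy => h (upd_subset hs (hU n) hy) (hv.upd n y) (by omega)

variable {X : Type (u + 1)} {K : Set (X → ZFSet.{u})} {a b c d : X → ZFSet.{u}}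

instance DT.num (n : ℕ) : DT K (fun _ => num n) := by
  induction n with
  | zero => rw [num_zero]; infer_instance
  | succ n ih => rw [num_succ]; infer_instance

instance DT.upd [DT K a] [DT K b] [DT K c] : DT K (fun x => upd (a x) (b x) (c x)) := by
  refine DT.app3 ?_ ‹_› ‹_› ‹_›
  unfold _root_.upd
  infer_instance

set_option synthInstance.maxSize 4096 in
set_option synthInstance.maxHeartbeats 400000 in
instance DT.Tr [ha : DT K a] [hb : DT K b] : DT K (fun x => Tr (a x) (b x)) := by
  refine DT.app2 (DT.recursion (F := _root_.Tr) (pd := fun x => x) inferInstance mem_wf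
    (fun U f g y => ∀ s, s ∈ y ↔ s ⊆ ZFSet.prod U U ∧ ∃ t x, ZOrd t ∧ ZOrd x ∧ f = _root_.J t x ∧
      TruthClause U t x s (fun h s' => ∃ d, ZFSet.pair h d ∈ g ∧ s' ∈ d)) ?_
    fun U f y => ?_) ha hb
  · simp only [TruthClause]
    infer_instance
  · simp only [pair_mem_graphOn, ZFSet.ext_iff (x := y), mem_Tr' (f := f), and_assoc,
      exists_and_left, exists_eq_left]

/-- `x` is the set defined from `A` by the formula and the level of the cumulative hierarchy coded
by the ordinal `ξ`. -/
def W (A ξ x : ZFSet.{u}) : Prop :=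
  ∃ α f, ZOrd α ∧ ZOrd f ∧ ξ = J α f ∧ A ∈ Vz α ∧ x ∈ Vz α ∧
    ∀ y ∈ Vz α, ({ZFSet.pair (num 0) y, ZFSet.pair (num 1) A} : ZFSet) ∈ Tr (Vz α) f ↔ y = x

theorem W.unique {A ξ x y : ZFSet.{u}} (hx : W A ξ x) (hy : W A ξ y) : x = y := by
  obtain ⟨α, f, hα, hf, rfl, -, hxV, hx⟩ := hx
  obtain ⟨α', f', hα', hf', h, -, -, hy⟩ := hy
  obtain ⟨rfl, rfl⟩ := (J_inj hα hf hα' hf').1 h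
  exact (hy x hxV).1 ((hx x hxV).2 rfl)

theorem W.zord {A ξ x : ZFSet.{u}} (hx : W A ξ x) : ZOrd ξ := by
  obtain ⟨α, f, hα, hf, rfl, -⟩ := hx
  exact hα.J hf

instance DP.W [ha : DT K a] [hb : DT K b] [hc : DT K c] : DP K (fun x => W (a x) (b x) (c x)) := by
  refine DP.app3 ?_ ha hb hc
  unfold _root_.W
  infer_instance

end Truth

section Reflection

theorem exists_witness_bound (β : Ordinal.{u}) : ∃ β' : Ordinal.{u}, β ≤ β' ∧
    ∀ (φ : Fml) (n : ℕ) (v : ℕ → ZFSet.{u}), (∀ k, v k ∈ vonNeumann β) →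
      (∃ x, ¬ FmlSat Set.univ φ (Function.update v n x)) →
      ∃ x ∈ vonNeumann β', ¬ FmlSat Set.univ φ (Function.update v n x) := by
  classical
  let ι := Fml × ℕ × (ℕ → {x // x ∈ vonNeumann β})
  have : Small.{u} Fml := small_zero _
  let r : ι → Ordinal.{u} := fun i =>
    if h : ∃ x, ¬ FmlSat Set.univ i.1 (Function.update (fun k => (i.2.2 k).1) i.2.1 x) then
      Order.succ (rank h.choose) else 0
  refine ⟨max β (⨆ i, r i), le_max_left _ _, fun φ n v hv h => ?_⟩
  let i : ι := (φ, n, fun k => ⟨v k, hv k⟩)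
  have hi : ∃ x, ¬ FmlSat Set.univ i.1 (Function.update (fun k => (i.2.2 k).1) i.2.1 x) := h
  refine ⟨hi.choose, ?_, hi.choose_spec⟩
  rw [mem_vonNeumann]
  refine lt_of_lt_of_le (Order.lt_succ _) (le_max_of_le_right ?_)
  have := Ordinal.le_iSup r i
  simp only [r] at this
  rwa [dif_pos hi] at this

/-- The reflection principle, for all formulas at once. -/
theorem exists_reflecting (S : ZFSet.{u}) : ∃ α : Ordinal.{u}, S ∈ vonNeumann α ∧
    ∀ (φ : Fml) (v : ℕ → ZFSet.{u}), (∀ n, v n ∈ vonNeumann α) →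
      (FmlSat {x | x ∈ vonNeumann α} φ v ↔ FmlSat Set.univ φ v) := by
  choose B hB hB' using exists_witness_bound.{u}
  let β : ℕ → Ordinal.{u} := fun n => B^[n] (Order.succ (rank S))
  have hβ : ∀ n, β (n + 1) = B (β n) := fun n => Function.iterate_succ_apply' _ _ _
  have hmono : Monotone β := monotone_nat_of_le_succ fun n => hβ n ▸ hB _
  have hmem : ∀ x, x ∈ vonNeumann (⨆ n, β n) ↔ ∃ n, x ∈ vonNeumann (β n) := fun x => by
    simp only [mem_vonNeumann, Ordinal.lt_iSup_iff]
  have hS : S ∈ vonNeumann (β 0) := mem_vonNeumann_succ S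
  have hempty : ∅ ∈ vonNeumann (β 0) := by simp [β]
  have tv : ∀ (φ : Fml) (n : ℕ) (v : ℕ → ZFSet.{u}), (∀ k, v k ∈ vonNeumann (⨆ n, β n)) →
      (∃ x, ¬ FmlSat Set.univ φ (Function.update v n x)) →
      ∃ x ∈ vonNeumann (⨆ n, β n), ¬ FmlSat Set.univ φ (Function.update v n x) := by
    intro φ n v hv h
    choose k hk using fun i => (hmem (v i)).1 (hv i)
    let m := (Finset.range φ.varBound).sup k
    let v' : ℕ → ZFSet.{u} := fun i => if i < φ.varBound then v i else ∅
    have hcongr : ∀ x, FmlSat Set.univ φ (Function.update v' n x) ↔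
        FmlSat Set.univ φ (Function.update v n x) := fun x => FmlSat.congr fun i hi => by
      by_cases hin : i = n
      · simp [hin]
      · simp [hin, v', hi]
    simp only [← hcongr] at h ⊢
    obtain ⟨x, hx, hx'⟩ := hB' (β m) φ n v' (fun i => by
      by_cases hi : i < φ.varBound
      · simp only [v', hi, if_true]
        exact vonNeumann_subset_of_le
          (hmono (Finset.le_sup (f := k) (Finset.mem_range.2 hi))) (hk i)
      · simp only [v', hi, if_false]
        exact vonNeumann_subset_of_le (hmono (Nat.zero_le _)) hempty) h
    exact ⟨x, (hmem x).2 ⟨m + 1, hβ m ▸ hx⟩, hx'⟩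
  refine ⟨⨆ n, β n, (hmem S).2 ⟨0, hS⟩, fun φ => ?_⟩
  induction φ with
  | mem i j | eq i j => exact fun v _ => Iff.rfl
  | impl φ ψ h₁ h₂ => exact fun v hv => imp_congr (h₁ v hv) (h₂ v hv)
  | not φ h => exact fun v hv => not_congr (h v hv)
  | all n φ h =>
    intro v hv
    have hupd : ∀ x ∈ vonNeumann (⨆ n, β n), ∀ k,
        Function.update v n x k ∈ vonNeumann (⨆ n, β n) := fun x hx k => by
      by_cases hk : k = n
      · simpa [hk] using hx
      · simpa [hk] using hv k
    constructor
    · intro H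
      by_contra hc
      simp only [FmlSat, Set.mem_univ, true_imp_iff, not_forall] at hc
      obtain ⟨x, hx, hx'⟩ := tv φ n v hv hc
      exact hx' ((h _ (hupd x hx)).1 (H x hx))
    · exact fun H x hx => (h _ (hupd x hx)).2 (H x (Set.mem_univ x))

end Reflection

section OrdinalDefinability

variable {A x y : ZFSet.{u}}

/-- The context whose constants are the ordinals and `A`. -/
def ordCtx (A : ZFSet.{u}) : Set (PUnit.{u + 2} → ZFSet.{u}) :=
  {f | ∃ c, (ZOrd c ∨ c = A) ∧ f = fun _ => c}

theorem zodp_iff_dt : ZODp A x ↔ DT (ordCtx A) (fun _ => x) := by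
  constructor
  · rintro ⟨φ, v, hv, h⟩
    refine ⟨φ, fun n => if n = 0 then Prod.snd else fun _ => v n, fun n => ?_, fun p => ?_⟩
    · by_cases hn : n = 0
      · exact .inl (.inl (by simp [hn]))
      · exact .inl (.inr ⟨fun _ => v n, ⟨v n, hv n, rfl⟩, by simp [hn]; rfl⟩)
    · refine Iff.trans ?_ (h p.2)
      refine iff_of_eq (congrArg _ (funext fun n => ?_))
      by_cases hn : n = 0 <;> simp [hn]
  · intro h
    obtain ⟨φ, w, hw, h⟩ := h.out.exists_update
    refine ⟨φ, fun n => w n PUnit.unit, fun n => ?_, fun y => h PUnit.unit y⟩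
    rcases hw n with ⟨c, hc, h⟩ | h
    · simpa only [h] using hc
    · simpa only [h] using .inl zord_empty

instance DT.parameter : DT (ordCtx A) (fun _ => A) := DT.of_mem_ctx ⟨A, .inr rfl, rfl⟩

theorem ZOrd.dt (h : ZOrd x) : DT (ordCtx A) (fun _ => x) := DT.of_mem_ctx ⟨x, .inl h, rfl⟩

theorem exists_W_of_zodp (h : ZODp A x) : ∃ ξ, W A ξ x := by
  classical
  obtain ⟨φ, v, hv, h⟩ := h
  obtain ⟨ψ, hψ⟩ := Fml.exists_subst.{u} φ
    (fun n => if n = 0 then 0 else if ZOrd (v n) then n + 2 else 1)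
  obtain ⟨α, hα, hrefl⟩ := exists_reflecting
    ({ZFSet.range (fun n : ULift.{u} ℕ => v n.down), {x, A}, Ordinal.omega0.toZFSet} : ZFSet.{u})
  have hU : vonNeumann α = Vz α.toZFSet := by rw [Vz, Ordinal.rank_toZFSet]
  rw [hU] at hα hrefl
  have htr : ∀ y z, y ∈ z → z ∈ Vz α.toZFSet → y ∈ Vz α.toZFSet := fun y z hy hz =>
    isTransitive_vonNeumann _ z hz hy
  set U := Vz α.toZFSet with hUdef
  have hvU : ∀ n, v n ∈ U := fun n => htr _ (ZFSet.range (fun n : ULift.{u} ℕ => v n.down))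
    (ZFSet.mem_range.2 ⟨⟨n⟩, rfl⟩) (htr _ _ (by simp) hα)
  have hxU : x ∈ U := htr _ {x, A} (by simp) (htr _ _ (by simp) hα)
  have hAU : A ∈ U := htr _ {x, A} (by simp) (htr _ _ (by simp) hα)
  have hnumU : ∀ n, num n ∈ U := fun n => htr _ Ordinal.omega0.toZFSet
    (Ordinal.toZFSet_mem_toZFSet_iff.2 (Ordinal.natCast_lt_omega0 n)) (htr _ _ (by simp) hα)
  have hemptyU : ∅ ∈ U := num_zero ▸ hnumU 0
  let p : ℕ → ZFSet.{u} := fun n => if ZOrd (v n) then v n else ∅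
  have hp : ∀ n, ZOrd (p n) := fun n => by
    by_cases hn : ZOrd (v n) <;> simp [p, hn, zord_empty]
  have hpU : ∀ n, p n ∈ U := fun n => by
    by_cases hn : ZOrd (v n) <;> simp [p, hn, hvU, hemptyU]
  let w : ZFSet.{u} → ℕ → ZFSet.{u} := fun y n =>
    if n = 0 then y else if n = 1 then A else p (n - 2)
  have hwU : ∀ y ∈ U, ∀ n, w y n ∈ U := fun y hy n => by
    simp only [w]
    split_ifs
    exacts [hy, hAU, hpU _]
  let g : ℕ → ZFSet.{u} := fun k => Nat.rec ψ.code
    (fun k g => J (num 5) (J (num (k + 2)) (J (p k) g))) k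
  have hg : ∀ k, ZOrd (g k) := fun k => by
    induction k with
    | zero => exact ψ.zord_code
    | succ k ih => exact (zord_num _).J ((zord_num _).J ((hp k).J ih))
  have key : ∀ y ∈ U, ∀ k s, s ⊆ ZFSet.prod U U →
      (∀ n, (n < 2 ∨ k + 2 ≤ n ∧ n < ψ.varBound + 2) →
        ∀ a, ZFSet.pair (num n) a ∈ s ↔ a = w y n) →
      (s ∈ Tr U (g k) ↔ FmlSat {x | x ∈ U} ψ (w y)) := by
    intro y hy k
    induction k with
    | zero =>
      exact fun s hs hrep => mem_Tr_code (N := ψ.varBound + 2) hnumU hs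
        (fun n hn => hrep n (by omega)) (by omega)
    | succ k ih =>
      intro s hs hrep
      change s ∈ Tr U (J (num 5) (J (num (k + 2)) (J (p k) (g k)))) ↔ _
      rw [mem_Tr_sub hs (zord_num _) (hp k) (hg k)]
      refine ih _ (upd_subset hs (hnumU _) (hpU k)) fun n hn a => ?_
      simp only [upd, mem_union, mem_sep, pair_inj, num_inj, mem_singleton]
      by_cases hnk : n = k + 2
      · simp [hnk, w]
      · have := hrep n (by omega) a
        simp [hnk, this]
  refine ⟨J α.toZFSet (g ψ.varBound), α.toZFSet, _, zord_toZFSet α, hg _, rfl, hAU, hxU,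
    fun y hy => ?_⟩
  rw [key y hy, hrefl ψ (w y) (hwU y hy), hψ, ← h y]
  · refine iff_of_eq (congrArg _ (funext fun n => ?_))
    by_cases hn : n = 0
    · simp [hn, w]
    by_cases hn' : ZOrd (v n)
    · simp [hn, hn', w, p]
    · simpa [hn, hn', w] using ((hv n).resolve_left hn').symm
  · intro z hz
    rcases ZFSet.mem_pair.1 hz with rfl | rfl
    · exact pair_mem_prod.2 ⟨hnumU 0, hy⟩
    · exact pair_mem_prod.2 ⟨hnumU 1, hAU⟩
  · intro n hn a
    obtain rfl | rfl : n = 0 ∨ n = 1 := by omega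
    · simp [pair_inj, num_inj, w]
    · simp [pair_inj, num_inj, w]

theorem zodp_iff_W : ZODp A x ↔ ∃ ξ, W A ξ x := by
  refine ⟨exists_W_of_zodp, fun ⟨ξ, h⟩ => zodp_iff_dt.2 ?_⟩
  have := h.zord.dt (A := A)
  exact DT.of_graph ((inferInstance : DP (extend (ordCtx A)) (fun p => W A ξ p.2)).congr
    fun p => ⟨fun h' => h'.unique h, fun e => e ▸ h⟩)

theorem inHODp_iff : InHODp A x ↔ ZODp A x ∧ ∀ y ∈ x, InHODp A y :=
  ⟨fun ⟨_, h, h'⟩ => ⟨h, h'⟩, fun h => ⟨x, h.1, h.2⟩⟩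

theorem inHODp_iff_exists : InHODp A x ↔
    ∃ t : ZFSet.{u}, t.IsTransitive ∧ x ∈ t ∧ ∀ y, y ∈ t → ZODp A y := by
  constructor
  · intro h
    refine ⟨ZFSet.sep (InHODp A) (vonNeumann (Order.succ (rank x))), fun y hy z hz => ?_,
      mem_sep.2 ⟨mem_vonNeumann_succ x, h⟩, fun y hy => (inHODp_iff.1 (mem_sep.1 hy).2).1⟩
    obtain ⟨hy, hy'⟩ := mem_sep.1 hy
    exact mem_sep.2 ⟨isTransitive_vonNeumann _ y hy hz, (inHODp_iff.1 hy').2 z hz⟩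
  · rintro ⟨t, ht, hx, h⟩
    induction x using ZFSet.inductionOn with
    | _ x ih => exact ⟨x, h x hx, fun y hy => ih y hy (ht x hx hy)⟩

variable {X : Type (u + 1)} {K : Set (X → ZFSet.{u})} {a b c d : X → ZFSet.{u}}

instance DP.zodp [ha : DT K a] [hb : DT K b] : DP K (fun x => ZODp (a x) (b x)) :=
  (DP.app2 (P := fun A x => ∃ ξ, _root_.W A ξ x) inferInstance ha hb).congr fun _ =>
    zodp_iff_W.symm

instance DP.inHODp [ha : DT K a] [hb : DT K b] : DP K (fun x => InHODp (a x) (b x)) :=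
  (DP.app2 (P := fun A x => ∃ t : ZFSet.{u}, t.IsTransitive ∧ x ∈ t ∧ ∀ y, y ∈ t → ZODp A y)
    inferInstance ha hb).congr fun _ => inHODp_iff_exists.symm

theorem zod_iff : ZOD x ↔ ZODp ∅ x :=
  exists₂_congr fun _ _ => and_congr_left' (forall_congr' fun _ =>
    ⟨.inl, fun h => h.elim id fun h => h ▸ zord_empty⟩)

theorem inHOD_iff : InHOD x ↔ InHODp ∅ x := by
  constructor
  · intro h
    induction h with
    | mk x h _ ih => exact ⟨x, zod_iff.1 h, ih⟩
  · intro h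
    induction h with
    | mk x h _ ih => exact ⟨x, zod_iff.2 h, ih⟩

instance DP.zod [ha : DT K a] : DP K (fun x => ZOD (a x)) :=
  (inferInstance : DP K (fun x => ZODp ∅ (a x))).congr fun _ => zod_iff.symm

theorem zord_inHODp (h : ZOrd x) : InHODp A x := by
  induction x using ZFSet.inductionOn with
  | _ x ih => exact ⟨x, zodp_iff_dt.2 h.dt, fun y hy => ih y hy (h.mem hy)⟩

theorem InHODp.dt (h : InHODp A x) : DT (ordCtx A) (fun _ => x) :=
  zodp_iff_dt.1 (inHODp_iff.1 h).1

theorem ordCtx_empty_subset : ∀ k ∈ ordCtx.{u} ∅, k ∘ (fun p => p) ∈ ordCtx A := by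
  rintro _ ⟨c, hc, rfl⟩
  exact ⟨c, .inl (hc.elim id fun h => h ▸ zord_empty), rfl⟩

theorem InHODp.of_empty (h : InHODp ∅ x) : InHODp A x := by
  induction h with
  | mk x h _ ih =>
    exact ⟨x, zodp_iff_dt.2 ((zodp_iff_dt.1 h).comp _ ordCtx_empty_subset), ih⟩

end OrdinalDefinability

section Models

variable {A x y : ZFSet.{u}}

theorem mk_ofNat (n : ℕ) : ZFSet.mk (PSet.ofNat.{u} n) = num n := by
  induction n with
  | zero => rw [num_zero]; rfl
  | succ n ih => rw [num_succ, ← ih]; rfl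

theorem omega_eq : ZFSet.omega.{u} = Ordinal.omega0.toZFSet := by
  ext z
  rw [Ordinal.mem_toZFSet_iff]
  constructor
  · induction z using Quotient.inductionOn with
    | _ z =>
      rintro ⟨⟨n⟩, h⟩
      exact ⟨n, Ordinal.natCast_lt_omega0 n, (mk_ofNat n).symm.trans (ZFSet.sound h.symm)⟩
  · rintro ⟨o, ho, rfl⟩
    obtain ⟨n, rfl⟩ := Ordinal.lt_omega0.1 ho
    change num n ∈ _
    rw [← mk_ofNat]
    exact ⟨⟨n⟩, PSet.Equiv.refl _⟩

theorem inHODp_of_dt (h : DT (ordCtx A) (fun _ => x)) (h' : ∀ y ∈ x, InHODp A y) : InHODp A x :=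
  ⟨x, zodp_iff_dt.2 h, h'⟩

theorem InHODp.mem (h : InHODp A x) (hy : y ∈ x) : InHODp A y := (inHODp_iff.1 h).2 y hy

theorem InHODp.upair (hx : InHODp A x) (hy : InHODp A y) : InHODp A {x, y} :=
  have := hx.dt
  have := hy.dt
  inHODp_of_dt inferInstance fun z hz => by
    rcases ZFSet.mem_pair.1 hz with rfl | rfl <;> assumption

theorem InHODp.pair (hx : InHODp A x) (hy : InHODp A y) : InHODp A (ZFSet.pair x y) := by
  have : InHODp A {x} := by simpa using hx.upair hx
  exact this.upair (hx.upair hy)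

theorem InHODp.prod (hx : InHODp A x) (hy : InHODp A y) : InHODp A (ZFSet.prod x y) :=
  have := hx.dt
  have := hy.dt
  inHODp_of_dt inferInstance fun z hz => by
    obtain ⟨a, ha, b, hb, rfl⟩ := ZFSet.mem_prod.1 hz
    exact (hx.mem ha).pair (hy.mem hb)

/-- Definable subsets of elements of `HOD_A` are elements of `HOD_A`. -/
theorem InHODp.sep {R : ZFSet.{u} → Prop} (h : DP (extend (ordCtx A)) (fun p => R p.2))
    (hx : InHODp A x) : InHODp A (ZFSet.sep R x) :=
  have := hx.dt
  inHODp_of_dt (DT.sep (R := fun _ => R)) fun _ hz => hx.mem (mem_sep.1 hz).1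

/-- Satisfaction in `HOD_A` of a fixed formula is definable. -/
theorem DP.fmlSat (φ : Fml) {X : Type (u + 1)} {K : Set (X → ZFSet.{u})} (hA : DT K (fun _ => A))
    (f : ℕ → X → ZFSet.{u}) (hf : ∀ n, DT K (f n)) :
    DP K (fun x => FmlSat {x | InHODp A x} φ (fun n => f n x)) := by
  induction φ generalizing X with
  | mem i j =>
    have := hf i
    have := hf j
    exact (inferInstance : DP K (fun x => f i x ∈ f j x))
  | eq i j =>
    have := hf i
    have := hf j
    exact (inferInstance : DP K (fun x => f i x = f j x))
  | impl φ ψ h₁ h₂ => exact @DP.imp _ _ _ _ (h₁ hA f hf) (h₂ hA f hf)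
  | not φ h => exact @DP.not _ _ _ (h hA f hf)
  | all n φ h =>
    have := h (K := extend K) inferInstance (fun m p => if m = n then p.2 else f m p.1)
      (fun m => by
        by_cases hm : m = n
        · simp only [hm, if_true]
          infer_instance
        · simp only [hm, if_false]
          exact (hf m).comp _ fst_comp_mem_extend)
    refine (inferInstance : DP K (fun x => ∀ y, InHODp A y → FmlSat {x | InHODp A x} φ
      (fun m => if m = n then y else f m x))).congr fun x => ?_
    refine forall₂_congr fun y _ => iff_of_eq (congrArg _ (funext fun m => ?_))
    by_cases hm : m = n <;> simp [hm]

theorem DP.fmlSat_update (φ : Fml) {v : ℕ → ZFSet.{u}} (hv : ∀ n, InHODp A (v n)) :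
    DP (extend (ordCtx A)) (fun p => FmlSat {x | InHODp A x} φ (Function.update v 0 p.2)) := by
  refine (DP.fmlSat (A := A) φ inferInstance
    (fun n (p : _ × ZFSet.{u}) => Function.update v 0 p.2 n) fun n => ?_)
  by_cases hn : n = 0
  · simp only [hn, Function.update_self]
    infer_instance
  · simp only [Function.update_of_ne hn]
    have := (hv n).dt
    infer_instance

theorem DP.fmlSat_update_update (φ : Fml) {v : ℕ → ZFSet.{u}} (hv : ∀ n, InHODp A (v n)) :
    DP (extend (extend (ordCtx A))) (fun p => FmlSat {x | InHODp A x} φ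
      (Function.update (Function.update v 0 p.1.2) 1 p.2)) := by
  refine (DP.fmlSat (A := A) φ inferInstance
    (fun n (p : (_ × ZFSet.{u}) × ZFSet.{u}) =>
      Function.update (Function.update v 0 p.1.2) 1 p.2 n) fun n => ?_)
  by_cases hn : n = 1
  · simp only [hn, Function.update_self]
    infer_instance
  by_cases hn' : n = 0
  · simp only [hn', ne_eq, zero_ne_one, not_false_eq_true, Function.update_of_ne,
      Function.update_self]
    infer_instance
  · simp only [Function.update_of_ne hn, Function.update_of_ne hn']
    have := (hv n).dt
    infer_instance

/-- A set of sets ordinal definable from `A` has an element with least code. -/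
theorem exists_least_code (hy : ∀ a ∈ y, ZODp A a) (hne : y ≠ ∅) :
    ∃ a ∈ y, ∃ ξ, W A ξ a ∧ ∀ b ∈ y, a = b ∨ ∀ ζ, W A ζ b → ξ ∈ ζ := by
  obtain ⟨a₀, ha₀⟩ := (ZFSet.eq_empty_or_nonempty y).resolve_left hne
  obtain ⟨ξ₀, hξ₀⟩ := zodp_iff_W.1 (hy a₀ ha₀)
  obtain ⟨ξ, ⟨a, ha, hξ⟩, hmin⟩ := mem_wf.has_min {ξ | ∃ a ∈ y, W A ξ a} ⟨ξ₀, a₀, ha₀, hξ₀⟩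
  refine ⟨a, ha, ξ, hξ, fun b hb => or_iff_not_imp_left.2 fun hab ζ hζ => ?_⟩
  rcases (zord_iff.1 hξ.zord).mem_trichotomous (zord_iff.1 hζ.zord) with h | rfl | h
  · exact h
  · exact (hab (hξ.unique hζ)).elim
  · exact (hmin ζ ⟨b, hb, hζ⟩ h).elim

theorem modelsZFC_HODp (A : ZFSet.{u}) : ModelsZFC {x | InHODp A x} where
  empty_mem := zord_inHODp zord_empty
  omega_mem := by
    rw [omega_eq]
    exact zord_inHODp (zord_toZFSet _)
  pair_mem x hx y hy := InHODp.upair hx hy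
  union_mem x hx := by
    have := hx.dt
    refine inHODp_of_dt inferInstance fun z hz => ?_
    obtain ⟨y, hy, hz⟩ := mem_sUnion.1 hz
    exact (hx.mem hy).mem hz
  power_mem x hx := by
    have := hx.dt
    exact inHODp_of_dt (DT.sep (R := fun _ y => InHODp A y)) fun z hz => (mem_sep.1 hz).2
  sep_mem φ v hv x hx := InHODp.sep (DP.fmlSat_update φ hv) hx
  repl_mem φ v hv x hx := by
    classical
    have := hx.dt
    let Q : ZFSet.{u} → ZFSet.{u} → Prop := fun a b =>
      FmlSat {x | InHODp A x} φ (Function.update (Function.update v 0 a) 1 b)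
    let R : ZFSet.{u} → Prop := fun b => InHODp A b ∧
      ∃ a, a ∈ x ∧ Q a b ∧ ∀ b', InHODp A b' → Q a b' → b' = b
    have hQ : DP (extend (extend (ordCtx A))) (fun p => Q p.1.2 p.2) :=
      DP.fmlSat_update_update φ hv
    have hQ₁ : DP (extend (extend (ordCtx A))) (fun p => Q p.2 p.1.2) :=
      hQ.comp (fun p : (_ × ZFSet.{u}) × ZFSet.{u} => ((p.1.1, p.2), p.1.2)) (by
        rintro _ (rfl | ⟨_, rfl | ⟨k, hk, rfl⟩, rfl⟩)
        exacts [.inr ⟨_, .inl rfl, rfl⟩, .inl rfl, .inr ⟨_, .inr ⟨k, hk, rfl⟩, rfl⟩])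
    have hQ₂ : DP (extend (extend (extend (ordCtx A)))) (fun p => Q p.1.2 p.2) :=
      hQ.comp (fun p : ((_ × ZFSet.{u}) × ZFSet.{u}) × ZFSet.{u} => ((p.1.1.1, p.1.2), p.2)) (by
        rintro _ (rfl | ⟨_, rfl | ⟨k, hk, rfl⟩, rfl⟩)
        exacts [.inl rfl, .inr ⟨_, .inl rfl, rfl⟩,
          .inr ⟨_, .inr ⟨_, .inr ⟨k, hk, rfl⟩, rfl⟩, rfl⟩])
    have hR : DP (extend (ordCtx A)) (fun p => R p.2) := by
      simp only [R]
      infer_instance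
    obtain ⟨t, ht⟩ := exists_image (fun a => if h : ∃ b, InHODp A b ∧ Q a b then h.choose else ∅) x
    have key : ∀ b, b ∈ ZFSet.sep R t ↔ R b := fun b => by
      refine ⟨fun h => (mem_sep.1 h).2, fun h => mem_sep.2 ⟨(ht b).2 ?_, h⟩⟩
      obtain ⟨hb, a, ha, hab, huniq⟩ := h
      have hex : ∃ b, InHODp A b ∧ Q a b := ⟨b, hb, hab⟩
      refine ⟨a, ha, ?_⟩
      rw [dif_pos hex]
      exact (huniq _ hex.choose_spec.1 hex.choose_spec.2).symm
    exact ⟨_, inHODp_of_dt (DT.of_mem (R := fun _ => R) hR fun _ => key)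
      fun b hb => ((key b).1 hb).1, key⟩
  choice_wo x hx := by
    have hOD : ∀ y ⊆ x, ∀ a ∈ y, ZODp A a := fun y hy a ha => (inHODp_iff.1 (hx.mem (hy ha))).1
    have hr : ∀ {a b}, ZFSet.pair a b ∈ ZFSet.sep (fun z => ∃ a b, z = ZFSet.pair a b ∧
        ∃ ξ, W A ξ a ∧ ∀ ζ, W A ζ b → ξ ∈ ζ) (ZFSet.prod x x) ↔
        (a ∈ x ∧ b ∈ x) ∧ ∃ ξ, W A ξ a ∧ ∀ ζ, W A ζ b → ξ ∈ ζ := by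
      intro a b
      rw [mem_sep, pair_mem_prod]
      refine and_congr_right fun _ => ⟨?_, fun h => ⟨a, b, rfl, h⟩⟩
      rintro ⟨a', b', h, H⟩
      obtain ⟨rfl, rfl⟩ := pair_inj.1 h
      exact H
    refine ⟨_, InHODp.sep (R := fun z => ∃ a b, z = ZFSet.pair a b ∧
      ∃ ξ, W A ξ a ∧ ∀ ζ, W A ζ b → ξ ∈ ζ) inferInstance (InHODp.prod hx hx), ?_, ?_⟩
    · intro a ha b hb
      have hsub : ({a, b} : ZFSet) ⊆ x := fun z hz => by
        rcases ZFSet.mem_pair.1 hz with rfl | rfl <;> assumption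
      obtain ⟨c, hc, ξ, hξ, hmin⟩ := exists_least_code (hOD _ hsub)
        (ne_of_mem_of_not_mem' (ZFSet.mem_pair.2 (.inl rfl)) (ZFSet.notMem_empty a))
      rw [hr, hr]
      rcases ZFSet.mem_pair.1 hc with rfl | rfl
      · exact (hmin b (by simp)).imp id fun h => .inl ⟨⟨ha, hb⟩, ξ, hξ, h⟩
      · exact (hmin a (by simp)).imp Eq.symm fun h => .inr ⟨⟨hb, ha⟩, ξ, hξ, h⟩
    · intro y hy hne
      obtain ⟨a, ha, ξ, hξ, hmin⟩ := exists_least_code (hOD y hy) hne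
      exact ⟨a, ha, fun b hb => (hmin b hb).imp id fun h => hr.2 ⟨⟨hy ha, hy hb⟩, ξ, hξ, h⟩⟩

end Models

section TransitiveModels

variable {X Y : Type (u + 1)} {N : ZClass.{u}} {K : Set (X → ZFSet.{u})} {R S : X → Prop}
  {a b c : X → ZFSet.{u}}

/-- `N` is a transitive model of ZFC. -/
class TransModel (N : ZClass.{u}) : Prop where
  trans : ClassTransitive N
  zfc : ModelsZFC N

/-- `f` is one of the variables or constants of the context `K`. -/
class Var (K : Set (X → ZFSet.{u})) (f : X → ZFSet.{u}) : Prop where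
  out : f ∈ K

instance Var.snd {L : Set (Y → ZFSet.{u})} {g : Y → X × ZFSet.{u}} [h : Proj L (extend K) g] :
    Var L (fun p => (g p).2) := ⟨h.out _ (.inl rfl)⟩

instance Var.const {c : ZFSet.{u}} [h : Var K (fun _ => c)] : Var (extend K) (fun _ => c) :=
  ⟨.inr ⟨_, h.out, rfl⟩⟩

/-- The context whose constants are the elements of `N`. -/
def constCtx (N : ZClass.{u}) : Set (PUnit.{u + 2} → ZFSet.{u}) :=
  {f | ∃ c ∈ N, f = fun _ => c}

theorem Var.of_mem {c : ZFSet.{u}} (h : c ∈ N) : Var (constCtx N) (fun _ => c) := ⟨⟨c, h, rfl⟩⟩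

/-- `R` agrees, for arguments in `N`, with a relation definable over `N` in the context `K`. -/
class DefIn (N : ZClass.{u}) (K : Set (X → ZFSet.{u})) (R : X → Prop) : Prop where
  out : ∃ S, Dfn N K S ∧ ∀ x, (∀ k ∈ K, k x ∈ N) → (S x ↔ R x)

namespace DefIn

theorem congr (h : DefIn N K R) (e : ∀ x, (∀ k ∈ K, k x ∈ N) → (R x ↔ S x)) : DefIn N K S := by
  obtain ⟨T, hT, h⟩ := h.out
  exact ⟨T, hT, fun x hx => (h x hx).trans (e x hx)⟩

instance mem [ha : Var K a] [hb : Var K b] : DefIn N K (fun x => a x ∈ b x) :=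
  ⟨_, Dfn.mem ha.out hb.out, fun _ _ => Iff.rfl⟩

instance eq [ha : Var K a] [hb : Var K b] : DefIn N K (fun x => a x = b x) :=
  ⟨_, Dfn.eq ha.out hb.out, fun _ _ => Iff.rfl⟩

instance imp [hR : DefIn N K R] [hS : DefIn N K S] : DefIn N K (fun x => R x → S x) := by
  obtain ⟨T, hT, h⟩ := hR.out
  obtain ⟨T', hT', h'⟩ := hS.out
  exact ⟨_, hT.imp hT', fun x hx => imp_congr (h x hx) (h' x hx)⟩

instance and [hR : DefIn N K R] [hS : DefIn N K S] : DefIn N K (fun x => R x ∧ S x) := by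
  obtain ⟨T, hT, h⟩ := hR.out
  obtain ⟨T', hT', h'⟩ := hS.out
  exact ⟨_, hT.and hT', fun x hx => and_congr (h x hx) (h' x hx)⟩

instance or [hR : DefIn N K R] [hS : DefIn N K S] : DefIn N K (fun x => R x ∨ S x) := by
  obtain ⟨T, hT, h⟩ := hR.out
  obtain ⟨T', hT', h'⟩ := hS.out
  exact ⟨_, hT.or hT', fun x hx => or_congr (h x hx) (h' x hx)⟩

theorem mem_of_extend {x : X} {y : ZFSet.{u}} (hx : ∀ k ∈ K, k x ∈ N) (hy : y ∈ N) :
    ∀ k ∈ extend K, k (x, y) ∈ N := by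
  rintro _ (rfl | ⟨k, hk, rfl⟩)
  exacts [hy, hx k hk]

instance all {R : X → ZFSet.{u} → Prop} [hR : DefIn N (extend K) (fun p => R p.1 p.2)] :
    DefIn N K (fun x => ∀ y ∈ N, R x y) := by
  obtain ⟨T, hT, h⟩ := hR.out
  exact ⟨_, Dfn.ball (R := fun x y => T (x, y)) hT,
    fun x hx => forall₂_congr fun y hy => h _ (mem_of_extend hx hy)⟩

instance ex {R : X → ZFSet.{u} → Prop} [hR : DefIn N (extend K) (fun p => R p.1 p.2)] :
    DefIn N K (fun x => ∃ y ∈ N, R x y) := by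
  obtain ⟨T, hT, h⟩ := hR.out
  exact ⟨_, Dfn.bex (R := fun x y => T (x, y)) hT,
    fun x hx => exists_congr fun y => and_congr_right fun hy => h _ (mem_of_extend hx hy)⟩

variable [hN : TransModel N]

theorem comp_fst_mem (ha : a ∈ K) : a ∘ Prod.fst ∈ extend K := .inr ⟨a, ha, rfl⟩

instance ball {R : X → ZFSet.{u} → Prop} [ha : Var K a]
    [hR : DefIn N (extend K) (fun p => R p.1 p.2)] : DefIn N K (fun x => ∀ y ∈ a x, R x y) :=
  have : Var (extend K) (fun p => a p.1) := ⟨comp_fst_mem ha.out⟩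
  (inferInstance : DefIn N K (fun x => ∀ y ∈ N, y ∈ a x → R x y)).congr fun _ hx =>
    ⟨fun h y hy => h y (hN.trans _ (hx a ha.out) y hy) hy, fun h y _ hy => h y hy⟩

instance bex {R : X → ZFSet.{u} → Prop} [ha : Var K a]
    [hR : DefIn N (extend K) (fun p => R p.1 p.2)] : DefIn N K (fun x => ∃ y ∈ a x, R x y) :=
  have : Var (extend K) (fun p => a p.1) := ⟨comp_fst_mem ha.out⟩
  (inferInstance : DefIn N K (fun x => ∃ y ∈ N, y ∈ a x ∧ R x y)).congr fun _ hx =>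
    ⟨fun ⟨y, _, hy, h⟩ => ⟨y, hy, h⟩, fun ⟨y, hy, h⟩ => ⟨y, hN.trans _ (hx a ha.out) y hy, hy, h⟩⟩

instance eq_upair [ha : Var K a] [hb : Var K b] [hc : Var K c] :
    DefIn N K (fun x => a x = {b x, c x}) :=
  have : Var (extend K) (fun p => a p.1) := ⟨comp_fst_mem ha.out⟩
  have : Var (extend K) (fun p => b p.1) := ⟨comp_fst_mem hb.out⟩
  have : Var (extend K) (fun p => c p.1) := ⟨comp_fst_mem hc.out⟩
  (inferInstance : DefIn N K (fun x => (∀ y ∈ a x, y = b x ∨ y = c x) ∧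
      b x ∈ a x ∧ c x ∈ a x)).congr fun x hx => by
    constructor
    · rintro ⟨h, h₁, h₂⟩
      ext y
      rw [ZFSet.mem_pair]
      refine ⟨h y, ?_⟩
      rintro (rfl | rfl) <;> assumption
    · intro h
      simp [h]

end DefIn

theorem TransModel.pair_mem [hN : TransModel N] {x y : ZFSet.{u}} (hx : x ∈ N) (hy : y ∈ N) :
    ZFSet.pair x y ∈ N := by
  have h : ({x} : ZFSet) ∈ N := by simpa using hN.zfc.pair_mem x hx x hx
  exact hN.zfc.pair_mem _ h _ (hN.zfc.pair_mem x hx y hy)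

theorem TransModel.insert_mem [hN : TransModel N] {x y : ZFSet.{u}} (hx : x ∈ N) (hy : y ∈ N) :
    insert x y ∈ N := by
  have h : ({x} : ZFSet) ∈ N := by simpa using hN.zfc.pair_mem x hx x hx
  convert hN.zfc.union_mem _ (hN.zfc.pair_mem _ h y hy) using 1
  ext z
  simp

namespace DefIn

variable [hN : TransModel N]

instance eq_pair [ha : Var K a] [hb : Var K b] [hc : Var K c] :
    DefIn N K (fun x => a x = ZFSet.pair (b x) (c x)) :=
  have : Var (extend (extend K)) (fun p => a p.1.1) := ⟨comp_fst_mem (comp_fst_mem ha.out)⟩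
  have : Var (extend K) (fun p => b p.1) := ⟨comp_fst_mem hb.out⟩
  have : Var (extend (extend K)) (fun p => b p.1.1) := ⟨comp_fst_mem (comp_fst_mem hb.out)⟩
  have : Var (extend (extend K)) (fun p => c p.1.1) := ⟨comp_fst_mem (comp_fst_mem hc.out)⟩
  (inferInstance : DefIn N K (fun x => ∃ y ∈ N, y = {b x, b x} ∧ ∃ z ∈ N, z = {b x, c x} ∧
      a x = {y, z})).congr fun x hx => by
    constructor
    · rintro ⟨y, -, rfl, z, -, rfl, h⟩
      rw [h]
      simp [ZFSet.pair]
    · intro h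
      exact ⟨_, hN.zfc.pair_mem _ (hx b hb.out) _ (hx b hb.out), rfl,
        _, hN.zfc.pair_mem _ (hx b hb.out) _ (hx c hc.out), rfl, by rw [h]; simp [ZFSet.pair]⟩

instance pair_mem [ha : Var K a] [hb : Var K b] [hc : Var K c] :
    DefIn N K (fun x => ZFSet.pair (b x) (c x) ∈ a x) :=
  have : Var (extend K) (fun p => a p.1) := ⟨comp_fst_mem ha.out⟩
  have : Var (extend K) (fun p => b p.1) := ⟨comp_fst_mem hb.out⟩
  have : Var (extend K) (fun p => c p.1) := ⟨comp_fst_mem hc.out⟩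
  (inferInstance : DefIn N K (fun x => ∃ y ∈ a x, y = ZFSet.pair (b x) (c x))).congr
    fun x _ => by simp

end DefIn

variable [hN : TransModel N]

theorem constCtx_mem {k : PUnit.{u + 2} → ZFSet.{u}} (h : k ∈ constCtx N ∨ k = fun _ => ∅) (x) :
    k x ∈ N := by
  rcases h with ⟨c, hc, rfl⟩ | rfl
  exacts [hc, hN.zfc.empty_mem]

theorem TransModel.sep_mem {R : ZFSet.{u} → Prop} {x : ZFSet.{u}}
    (h : DefIn N (extend (constCtx N)) (fun p => R p.2)) (hx : x ∈ N) : ZFSet.sep R x ∈ N := by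
  obtain ⟨T, hT, h⟩ := h.out
  obtain ⟨φ, w, hw, hφ⟩ := hT.exists_update
  convert hN.zfc.sep_mem φ (fun n => w n ⟨⟩) (fun n => constCtx_mem (hw n) _) x hx using 1
  ext y
  rw [mem_sep, mem_sep]
  refine and_congr_right fun hy => ?_
  rw [hφ, h (⟨⟩, y) (DefIn.mem_of_extend (fun k hk => constCtx_mem (.inl hk) _)
    (hN.trans x hx y hy))]

theorem TransModel.repl_mem {R : ZFSet.{u} → ZFSet.{u} → Prop} {x : ZFSet.{u}}
    (h : DefIn N (extend (extend (constCtx N))) (fun p => R p.1.2 p.2)) (hx : x ∈ N)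
    (hR : ∀ a ∈ x, ∀ b ∈ N, ∀ b' ∈ N, R a b → R a b' → b' = b) :
    ∃ z ∈ N, ∀ b, b ∈ z ↔ b ∈ N ∧ ∃ a ∈ x, R a b := by
  obtain ⟨T, hT, h⟩ := h.out
  obtain ⟨φ, w, hw, hφ⟩ := hT.exists_update_update
  obtain ⟨z, hz, H⟩ := hN.zfc.repl_mem φ (fun n => w n ⟨⟩) (fun n => constCtx_mem (hw n) _) x hx
  have key : ∀ a ∈ x, ∀ b ∈ N, T ((⟨⟩, a), b) ↔ R a b := fun a ha b hb =>
    h ((⟨⟩, a), b) (DefIn.mem_of_extend (DefIn.mem_of_extend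
      (fun k hk => constCtx_mem (.inl hk) _) (hN.trans x hx a ha)) hb)
  refine ⟨z, hz, fun b => (H b).trans (and_congr_right fun hb => exists_congr fun a =>
    and_congr_right fun ha => ?_)⟩
  simp only [hφ]
  rw [key a ha b hb]
  exact ⟨fun h => h.1, fun h => ⟨h, fun b' hb' h' =>
    hR a ha b hb b' hb' h ((key a ha b' hb').1 h')⟩⟩

/-- Approximations in `N` to the collapse of the relation `R` on `D`. -/
def Attempt (N : ZClass.{u}) (D R f : ZFSet.{u}) : Prop :=
  ∀ ζ ∈ D, ∀ b ∈ N, ZFSet.pair ζ b ∈ f →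
    (∀ ν ∈ D, ZFSet.pair ν ζ ∈ R → ∃ w ∈ b, ZFSet.pair ν w ∈ f) ∧
    ∀ w ∈ b, ∃ ν ∈ D, ZFSet.pair ν ζ ∈ R ∧ ZFSet.pair ν w ∈ f

instance DefIn.attempt [ha : Var K a] [hb : Var K b] [hc : Var K c] :
    DefIn N K (fun x => Attempt N (a x) (b x) (c x)) := by
  have va : Var (extend (extend K)) (fun p => a p.1.1) := ⟨comp_fst_mem (comp_fst_mem ha.out)⟩
  have va' : Var (extend (extend (extend K))) (fun p => a p.1.1.1) := ⟨comp_fst_mem va.out⟩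
  have vb : Var (extend (extend (extend K))) (fun p => b p.1.1.1) :=
    ⟨comp_fst_mem (comp_fst_mem (comp_fst_mem hb.out))⟩
  have vb' : Var (extend (extend (extend (extend K)))) (fun p => b p.1.1.1.1) :=
    ⟨comp_fst_mem vb.out⟩
  have vc : Var (extend (extend K)) (fun p => c p.1.1) := ⟨comp_fst_mem (comp_fst_mem hc.out)⟩
  have vc' : Var (extend (extend (extend (extend K)))) (fun p => c p.1.1.1.1) :=
    ⟨comp_fst_mem (comp_fst_mem vc.out)⟩
  unfold Attempt
  infer_instance

/-- Transitive models are closed under collapsing well-founded relations. -/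
theorem TransModel.collapse_mem {D R : ZFSet.{u}} (hD : D ∈ N) (hR : R ∈ N)
    {e : ZFSet.{u} → ZFSet.{u}}
    (he : ∀ ζ ∈ D, ∀ w, w ∈ e ζ ↔ ∃ ν ∈ D, ZFSet.pair ν ζ ∈ R ∧ w = e ν) :
    ∀ ζ ∈ D, e ζ ∈ N := by
  have vD := Var.of_mem hD
  have vR := Var.of_mem hR
  have DN : ∀ {ζ}, ζ ∈ D → ζ ∈ N := fun h => hN.trans _ hD _ h
  have correct : ∀ f, Attempt N D R f → ∀ x, ∀ ζ ∈ D, x = e ζ → ∀ b ∈ N, ZFSet.pair ζ b ∈ f →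
      b = e ζ := by
    intro f hf x
    induction x using ZFSet.inductionOn with
    | _ x ih =>
      rintro ζ hζ rfl b hb hζb
      obtain ⟨h₁, h₂⟩ := hf ζ hζ b hb hζb
      ext w
      rw [he ζ hζ]
      constructor
      · intro hw
        obtain ⟨ν, hν, hr, hνw⟩ := h₂ w hw
        exact ⟨ν, hν, hr, ih _ ((he ζ hζ _).2 ⟨ν, hν, hr, rfl⟩) ν hν rfl w (hN.trans b hb w hw) hνw⟩
      · rintro ⟨ν, hν, hr, rfl⟩
        obtain ⟨w, hw, hνw⟩ := h₁ ν hν hr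
        rwa [← ih _ ((he ζ hζ _).2 ⟨ν, hν, hr, rfl⟩) ν hν rfl w (hN.trans b hb w hw) hνw]
  obtain ⟨E, hE, hEmem⟩ := hN.repl_mem (x := D) (R := fun ζ z => ∃ f ∈ N, Attempt N D R f ∧
      ∃ b ∈ N, z = ZFSet.pair ζ b ∧ z ∈ f) inferInstance hD (by
    rintro ζ hζ _ - _ - ⟨f, -, hf, b, hb, rfl, hbf⟩ ⟨f', -, hf', b', hb', rfl, hbf'⟩
    rw [correct f hf _ ζ hζ rfl b hb hbf, correct f' hf' _ ζ hζ rfl b' hb' hbf'])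
  have vE := Var.of_mem hE
  have mem_E : ∀ {ζ b}, ZFSet.pair ζ b ∈ E ↔ ζ ∈ D ∧ b ∈ N ∧ ∃ f ∈ N, Attempt N D R f ∧
      ZFSet.pair ζ b ∈ f := by
    intro ζ b
    rw [hEmem]
    constructor
    · rintro ⟨-, ζ', hζ', f, hf, hf', b', hb', h, hbf⟩
      obtain ⟨rfl, rfl⟩ := pair_inj.1 h
      exact ⟨hζ', hb', f, hf, hf', hbf⟩
    · rintro ⟨hζ, hb, f, hf, hf', hbf⟩
      exact ⟨hN.pair_mem (DN hζ) hb, ζ, hζ, f, hf, hf', b, hb, rfl, hbf⟩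
  have hEA : Attempt N D R E := by
    intro ζ hζ b hb h
    obtain ⟨-, -, f, hf, hf', hbf⟩ := mem_E.1 h
    obtain ⟨h₁, h₂⟩ := hf' ζ hζ b hb hbf
    refine ⟨fun ν hν hr => ?_, fun w hw => ?_⟩
    · obtain ⟨w, hw, hνw⟩ := h₁ ν hν hr
      exact ⟨w, hw, mem_E.2 ⟨hν, hN.trans b hb w hw, f, hf, hf', hνw⟩⟩
    · obtain ⟨ν, hν, hr, hνw⟩ := h₂ w hw
      exact ⟨ν, hν, hr, mem_E.2 ⟨hν, hN.trans b hb w hw, f, hf, hf', hνw⟩⟩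
  suffices H : ∀ x, ∀ ζ ∈ D, x = e ζ → e ζ ∈ N ∧ ZFSet.pair ζ (e ζ) ∈ E from
    fun ζ hζ => (H _ ζ hζ rfl).1
  intro x
  induction x using ZFSet.inductionOn with
  | _ x ih =>
    rintro ζ hζ rfl
    have vζ := Var.of_mem (DN hζ)
    have ih' : ∀ ν ∈ D, ZFSet.pair ν ζ ∈ R → e ν ∈ N ∧ ZFSet.pair ν (e ν) ∈ E :=
      fun ν hν hr => ih _ ((he ζ hζ _).2 ⟨ν, hν, hr, rfl⟩) ν hν rfl
    have hmem : e ζ ∈ N := by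
      obtain ⟨z, hz, hzmem⟩ := hN.repl_mem (x := D)
        (R := fun ν w => ZFSet.pair ν ζ ∈ R ∧ ZFSet.pair ν w ∈ E) inferInstance hD
        (fun ν hν b hb b' hb' h h' => by
          rw [correct E hEA _ ν hν rfl b hb h.2, correct E hEA _ ν hν rfl b' hb' h'.2])
      convert hz
      ext w
      rw [he ζ hζ, hzmem]
      constructor
      · rintro ⟨ν, hν, hr, rfl⟩
        exact ⟨(ih' ν hν hr).1, ν, hν, hr, (ih' ν hν hr).2⟩
      · rintro ⟨hw, ν, hν, hr, hνw⟩
        exact ⟨ν, hν, hr, correct E hEA _ ν hν rfl w hw hνw⟩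
    refine ⟨hmem, mem_E.2 ⟨hζ, hmem, insert (ZFSet.pair ζ (e ζ)) E,
      hN.insert_mem (hN.pair_mem (DN hζ) hmem) hE, ?_, ZFSet.mem_insert _ _⟩⟩
    intro ζ' hζ' b hb h
    rcases ZFSet.mem_insert_iff.1 h with h | h
    · obtain ⟨rfl, rfl⟩ := pair_inj.1 h
      refine ⟨fun ν hν hr => ⟨e ν, (he _ hζ _).2 ⟨ν, hν, hr, rfl⟩,
        ZFSet.mem_insert_of_mem _ (ih' ν hν hr).2⟩, fun w hw => ?_⟩
      obtain ⟨ν, hν, hr, rfl⟩ := (he _ hζ _).1 hw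
      exact ⟨ν, hν, hr, ZFSet.mem_insert_of_mem _ (ih' ν hν hr).2⟩
    · obtain ⟨h₁, h₂⟩ := hEA ζ' hζ' b hb h
      refine ⟨fun ν hν hr => ?_, fun w hw => ?_⟩
      · obtain ⟨w, hw, hνw⟩ := h₁ ν hν hr
        exact ⟨w, hw, ZFSet.mem_insert_of_mem _ hνw⟩
      · obtain ⟨ν, hν, hr, hνw⟩ := h₂ w hw
        exact ⟨ν, hν, hr, ZFSet.mem_insert_of_mem _ hνw⟩

end TransitiveModels

section Vopenka

variable {X : Type (u + 1)} {K : Set (X → ZFSet.{u})} {a b : X → ZFSet.{u}}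
  {A η P g x y B Y : ZFSet.{u}} {c : ZFSet.{u} → ZFSet.{u}} {N : ZClass.{u}}

/-- All ordinals are constants of the context `K`. -/
class HasOrds (K : Set (X → ZFSet.{u})) : Prop where
  out : ∀ o, ZOrd o → (fun _ => o) ∈ K

instance HasOrds.ordCtx : HasOrds (ordCtx A) := ⟨fun o h => ⟨o, .inl h, rfl⟩⟩

instance HasOrds.extend [h : HasOrds K] : HasOrds (extend K) :=
  ⟨fun o ho => .inr ⟨_, h.out o ho, rfl⟩⟩

/-- `c` is an ordinal definable injective coding of Vopěnka conditions on `η` by ordinals. -/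
class Coding (η : ZFSet.{u}) (c : ZFSet.{u} → ZFSet.{u}) : Prop where
  zord : ZOrd η
  odMap : ODMap c {B | VCond η B}
  zord_code : ∀ B, VCond η B → ZOrd (c B)
  inj : ∀ B₁ B₂, VCond η B₁ → VCond η B₂ → c B₁ = c B₂ → B₁ = B₂

/-- `p` is the code of the Vopěnka condition `B`. -/
def IsCode (η : ZFSet.{u}) (c : ZFSet.{u} → ZFSet.{u}) (B p : ZFSet.{u}) : Prop :=
  VCond η B ∧ p = c B

instance DP.isCode [hc : Coding η c] [hK : HasOrds K] [ha : DT K a] [hb : DT K b] :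
    DP K (fun x => IsCode η c (a x) (b x)) := by
  refine DP.subst (R := fun x y => IsCode η c y (b x)) ?_ ha
  refine DP.subst (R := fun p y => IsCode η c p.2 y) ?_ (hb.comp Prod.fst fst_comp_mem_extend)
  obtain ⟨φ, v, hv, hφ⟩ := hc.odMap
  have hη : DT K (fun _ => η) := DT.of_mem_ctx (hK.out η hc.zord)
  have hV : DP (extend (extend K)) (fun p => VCond η p.1.2) := by
    unfold VCond
    infer_instance
  have hφK : DP (extend (extend K)) (fun p =>
      FmlSat Set.univ φ (Function.update (Function.update v 0 p.1.2) 1 p.2)) := by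
    refine ⟨φ, fun n p => Function.update (Function.update v 0 p.1.2) 1 p.2 n, fun n => .inl ?_,
      fun p => Iff.rfl⟩
    by_cases h₁ : n = 1
    · subst h₁
      exact .inl (by simp only [Function.update_self])
    by_cases h₀ : n = 0
    · subst h₀
      exact .inr ⟨_, .inl rfl, by simp only [Function.update_of_ne h₁, Function.update_self]; rfl⟩
    · simp only [Function.update_of_ne h₁, Function.update_of_ne h₀]
      exact HasOrds.out _ (hv n)
  exact (inferInstance : DP (extend (extend K)) (fun p => VCond η p.1.2 ∧
    FmlSat Set.univ φ (Function.update (Function.update v 0 p.1.2) 1 p.2))).congr fun p =>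
    and_congr_right fun h => hφ _ h _

theorem zod_iff_dt : ZOD x ↔ DT (ordCtx ∅) (fun _ => x) := zod_iff.trans zodp_iff_dt

theorem vcond_sep {R : ZFSet.{u} → Prop} (hη : ZOrd η)
    (h : DP (extend (ordCtx ∅)) (fun p => R p.2)) (hA : A ⊆ η) (hR : R A) :
    VCond η (ZFSet.sep R (ZFSet.powerset η)) ∧ A ∈ ZFSet.sep R (ZFSet.powerset η) := by
  have := hη.dt (A := ∅)
  have hmem : A ∈ ZFSet.sep R (ZFSet.powerset η) := mem_sep.2 ⟨mem_powerset.2 hA, hR⟩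
  exact ⟨⟨zod_iff_dt.2 (DT.sep (R := fun _ => R)),
    ne_of_mem_of_not_mem' hmem (ZFSet.notMem_empty A), fun z hz => (mem_sep.1 hz).1⟩, hmem⟩

/-- The filter of conditions containing `A` meets every dense set in `HOD`. -/
theorem exists_mem_dense [hc : Coding η c] {D : ZFSet.{u}} (hD : InHODp ∅ D)
    (hdense : ∀ B, VCond η B → ∃ B', VCond η B' ∧ c B' ∈ D ∧ B' ⊆ B) (hA : A ⊆ η) :
    ∃ B, VCond η B ∧ A ∈ B ∧ c B ∈ D := by
  have := hD.dt
  let R : ZFSet.{u} → Prop := fun A' => ∃ B p, IsCode η c B p ∧ A' ∈ B ∧ p ∈ D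
  have hR : DP (extend (ordCtx ∅)) (fun p => ¬ R p.2) := by
    simp only [R]
    infer_instance
  by_contra hcon
  have hRA : ¬ R A := by
    rintro ⟨B, _, ⟨hB, rfl⟩, hAB, hp⟩
    exact hcon ⟨B, hB, hAB, hp⟩
  obtain ⟨B', hB', hB'D, hsub⟩ := hdense _ (vcond_sep (R := fun A' => ¬ R A') hc.zord hR hA hRA).1
  obtain ⟨z, hz⟩ := (ZFSet.eq_empty_or_nonempty B').resolve_left hB'.2.1
  exact (mem_sep.1 (hsub hz)).2 ⟨B', _, ⟨hB', rfl⟩, hz, hB'D⟩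

theorem inHODp_conditions [hc : Coding η c] (hP : ∀ p, p ∈ P ↔ ∃ B, IsCode η c B p) :
    InHODp ∅ P :=
  inHODp_of_dt (DT.of_mem (R := fun _ p => ∃ B, IsCode η c B p) inferInstance fun _ => hP)
    fun p hp => by
      obtain ⟨B, hB, rfl⟩ := (hP p).1 hp
      exact zord_inHODp (hc.zord_code B hB)

theorem inHODp_generic [hc : Coding η c] (hg : ∀ p, p ∈ g ↔ ∃ B, IsCode η c B p ∧ A ∈ B) :
    InHODp A g :=
  inHODp_of_dt (DT.of_mem (R := fun _ p => ∃ B, IsCode η c B p ∧ A ∈ B) inferInstance fun _ => hg)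
    fun p hp => by
      obtain ⟨B, ⟨hB, rfl⟩, -⟩ := (hg p).1 hp
      exact zord_inHODp (hc.zord_code B hB)

/-- Subsets of elements of `HOD` that are ordinal definable from `A` have Vopěnka names. -/
theorem mem_of_subset_of_zodp [hN : TransModel N] [hc : Coding η c] (hAη : A ⊆ η)
    (hP : ∀ p, p ∈ P ↔ ∃ B, IsCode η c B p) (hHOD : ∀ x, InHODp ∅ x → x ∈ N) (hgN : g ∈ N)
    (hg : ∀ p, p ∈ g ↔ ∃ B, IsCode η c B p ∧ A ∈ B) (hY : InHODp ∅ Y) (hxY : x ⊆ Y)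
    (hx : ZODp A x) : x ∈ N := by
  obtain ⟨ξ, hξ⟩ := zodp_iff_W.1 hx
  have dξ := hξ.zord.dt (A := ∅)
  have dη := hc.zord.dt (A := ∅)
  let Bset : ZFSet.{u} → ZFSet.{u} := fun y =>
    ZFSet.sep (fun A' => ∃ x', W A' ξ x' ∧ y ∈ x') (ZFSet.powerset η)
  let name := ZFSet.sep (fun z => ∃ y p, z = ZFSet.pair y p ∧ IsCode η c (Bset y) p)
    (ZFSet.prod Y P)
  have hname : InHODp ∅ name :=
    InHODp.sep (by simp only [Bset]; infer_instance) (hY.prod (inHODp_conditions hP))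
  have vname := Var.of_mem (hHOD _ hname)
  have vg := Var.of_mem hgN
  have mem_name : ∀ {y p}, ZFSet.pair y p ∈ name ↔ y ∈ Y ∧ IsCode η c (Bset y) p := by
    intro y p
    rw [mem_sep, pair_mem_prod]
    constructor
    · rintro ⟨⟨hy, -⟩, y', p', h, H⟩
      obtain ⟨rfl, rfl⟩ := pair_inj.1 h
      exact ⟨hy, H⟩
    · rintro ⟨hy, H⟩
      exact ⟨⟨hy, (hP p).2 ⟨_, H⟩⟩, y, p, rfl, H⟩
  have hmem := hN.sep_mem (R := fun y => ∃ p ∈ g, ZFSet.pair y p ∈ name) inferInstance (hHOD _ hY)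
  convert hmem
  ext y
  rw [mem_sep]
  constructor
  · intro hy
    have dy := (hY.mem (hxY hy)).dt
    obtain ⟨h₁, h₂⟩ := vcond_sep (R := fun A' => ∃ x', W A' ξ x' ∧ y ∈ x') hc.zord inferInstance
      hAη ⟨x, hξ, hy⟩
    exact ⟨hxY hy, _, (hg _).2 ⟨_, ⟨h₁, rfl⟩, h₂⟩, mem_name.2 ⟨hxY hy, h₁, rfl⟩⟩
  · rintro ⟨hy, p, hp, hyp⟩
    obtain ⟨-, hB, rfl⟩ := mem_name.1 hyp
    obtain ⟨B, ⟨hB', h⟩, hAB⟩ := (hg _).1 hp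
    rw [← hc.inj _ _ hB hB' h] at hAB
    obtain ⟨-, x', hx', hyx'⟩ := mem_sep.1 hAB
    rwa [hξ.unique hx']

theorem exists_zord_superset (hs : ∀ o ∈ x, ZOrd o) : ∃ θ, ZOrd θ ∧ x ⊆ θ := by
  refine ⟨(rank x).toZFSet, zord_toZFSet _, fun o ho => ?_⟩
  obtain ⟨α, rfl⟩ := (hs o ho).exists_eq
  simpa using rank_lt_of_mem ho

/-- Every transitive model containing `HOD` and the Vopěnka generic contains `HOD_A`. -/
theorem mem_of_inHODp [hN : TransModel N] [hc : Coding η c] (hAη : A ⊆ η)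
    (hP : ∀ p, p ∈ P ↔ ∃ B, IsCode η c B p) (hHOD : ∀ x, InHODp ∅ x → x ∈ N) (hgN : g ∈ N)
    (hg : ∀ p, p ∈ g ↔ ∃ B, IsCode η c B p ∧ A ∈ B) (hx : InHODp A x) : x ∈ N := by
  classical
  have dx := hx.dt
  let t := ZFSet.sep (InHODp A) (Vz {x})
  have dt : DT (ordCtx A) (fun _ => t) := DT.sep (R := fun _ => InHODp A)
  have hxt : x ∈ t := mem_sep.2 ⟨mem_vonNeumann.2 (rank_lt_of_mem (ZFSet.mem_singleton.2 rfl)), hx⟩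
  have htrans : ∀ {u w}, u ∈ w → w ∈ t → u ∈ t := fun hu hw =>
    mem_sep.2 ⟨mem_vonNeumann.2 ((rank_lt_of_mem hu).trans (mem_vonNeumann.1 (mem_sep.1 hw).1)),
      (mem_sep.1 hw).2.mem hu⟩
  have hcode : ∀ u, ∃ ξ, u ∈ t → W A ξ u := fun u => by
    by_cases hu : u ∈ t
    · obtain ⟨ξ, hξ⟩ := zodp_iff_W.1 (inHODp_iff.1 (mem_sep.1 hu).2).1
      exact ⟨ξ, fun _ => hξ⟩
    · exact ⟨∅, fun h => (hu h).elim⟩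
  choose F hF using hcode
  obtain ⟨s, hs⟩ := exists_image F t
  obtain ⟨θ, hθ, hsθ⟩ := exists_zord_superset (x := s) fun o ho => by
    obtain ⟨u, hu, rfl⟩ := (hs o).1 ho
    exact (hF u hu).zord
  have hFθ : ∀ u ∈ t, F u ∈ θ := fun u hu => hsθ ((hs _).2 ⟨u, hu, rfl⟩)
  let R := ZFSet.sep (fun z => ∃ ν ζ, z = ZFSet.pair ν ζ ∧
    ∃ u w, u ∈ t ∧ w ∈ t ∧ W A ν u ∧ W A ζ w ∧ u ∈ w) (ZFSet.prod θ θ)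
  have dθ := hθ.dt (A := A)
  have hR : R ∈ N := mem_of_subset_of_zodp hAη hP hHOD hgN hg
    ((zord_inHODp hθ).prod (zord_inHODp hθ)) (fun z hz => (mem_sep.1 hz).1)
    (zodp_iff_dt.2 inferInstance)
  let e : ZFSet.{u} → ZFSet.{u} := fun ζ =>
    if h : ∃ u ∈ t, W A ζ u then h.choose else ∅
  have he : ∀ {ζ u}, u ∈ t → W A ζ u → e ζ = u := fun {ζ u} hu hζ => by
    have h : ∃ u ∈ t, W A ζ u := ⟨u, hu, hζ⟩
    simp only [e, dif_pos h]
    exact h.choose_spec.2.unique hζ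
  have key := hN.collapse_mem (hHOD θ (zord_inHODp hθ)) hR (e := e) (fun ζ hζ w => by
    constructor
    · intro hw
      by_cases h : ∃ u ∈ t, W A ζ u
      · obtain ⟨u, hu, hζu⟩ := h
        rw [he hu hζu] at hw
        have hwt := htrans hw hu
        exact ⟨F w, hFθ w hwt, mem_sep.2 ⟨pair_mem_prod.2 ⟨hFθ w hwt, hζ⟩, F w, ζ, rfl, w, u, hwt,
          hu, hF w hwt, hζu, hw⟩, (he hwt (hF w hwt)).symm⟩
      · simp only [e, dif_neg h] at hw
        exact (ZFSet.notMem_empty _ hw).elim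
    · rintro ⟨ν, hν, hr, rfl⟩
      obtain ⟨-, ν', ζ', h, u, w, hu, hw, hνu, hζw, huw⟩ := mem_sep.1 hr
      obtain ⟨rfl, rfl⟩ := pair_inj.1 h
      rwa [he hu hνu, he hw hζw])
  rw [← he hxt (hF x hxt)]
  exact key _ (hFθ x hxt)

end Vopenka

/-- Let `A` be a set of ordinals and let `ℙ` be the Vopěnka forcing whose conditions are
ordinal codes (via an OD coding `c`) for nonempty OD sets of subsets of `η ⊇ A`, ordered
by inclusion. Then the filter `G_A` of conditions whose decoded set contains `A` is
`(HOD,ℙ)`-generic and `HOD[G_A] = HOD_A`. -/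
theorem vopenka_generic_gives_HOD_A
    (A η : ZFSet) (hA : ∀ a ∈ A, ZOrd a) (hη : ZOrd η) (hAη : A ⊆ η)
    (c : ZFSet → ZFSet)
    (hcOD : ODMap c {B | VCond η B})
    (hcOrd : ∀ B : ZFSet, VCond η B → ZOrd (c B))
    (hcInj : ∀ B₁ B₂ : ZFSet, VCond η B₁ → VCond η B₂ → c B₁ = c B₂ → B₁ = B₂)
    (P le : ZFSet)
    (hPc : ∀ p : ZFSet, p ∈ P ↔ ∃ B : ZFSet, VCond η B ∧ p = c B)
    (hlec : ∀ z : ZFSet, z ∈ le ↔ ∃ B₁ B₂ : ZFSet,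
        VCond η B₁ ∧ VCond η B₂ ∧ B₁ ⊆ B₂ ∧ z = ZFSet.pair (c B₁) (c B₂))
    (GA : Set ZFSet)
    (hGA : GA = {p : ZFSet | ∃ B : ZFSet, VCond η B ∧ A ∈ B ∧ p = c B}) :
    ZGeneric HODc P le GA ∧ IsGenericExt HODc GA {x : ZFSet | InHODp A x} := by
  subst hGA
  have hc : Coding η c := ⟨hη, hcOD, hcOrd, hcInj⟩
  have hg_iff : ∀ {g}, Codes g {p : ZFSet | ∃ B : ZFSet, VCond η B ∧ A ∈ B ∧ p = c B} →
      ∀ p, p ∈ g ↔ ∃ B, IsCode η c B p ∧ A ∈ B := fun h p =>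
    (h p).trans (exists_congr fun B => by unfold IsCode; tauto)
  refine ⟨⟨⟨?_, ?_, ?_, ?_⟩, ?_⟩, fun x hx y hy => hx.mem hy, modelsZFC_HODp A,
    fun x hx => (inHOD_iff.1 hx).of_empty, ?_, ?_⟩
  · rintro p ⟨B, hB, -, rfl⟩
    exact (hPc _).2 ⟨B, hB, rfl⟩
  · obtain ⟨h₁, h₂⟩ := vcond_sep (R := fun B => B = B) hη inferInstance hAη rfl
    exact ⟨_, _, h₁, h₂, rfl⟩
  · rintro p ⟨B, hB, hAB, rfl⟩ q - hle
    obtain ⟨B₁, B₂, h₁, h₂, hsub, h⟩ := (hlec _).1 hle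
    obtain ⟨h', rfl⟩ := pair_inj.1 h
    obtain rfl := hcInj _ _ hB h₁ h'
    exact ⟨B₂, h₂, hsub hAB, rfl⟩
  · rintro _ ⟨B₁, h₁, hA₁, rfl⟩ _ ⟨B₂, h₂, hA₂, rfl⟩
    have := zod_iff_dt.1 h₁.1
    have := zod_iff_dt.1 h₂.1
    obtain ⟨h, hA⟩ := vcond_sep (R := fun z => z ∈ B₁ ∧ z ∈ B₂) hη inferInstance hAη ⟨hA₁, hA₂⟩
    exact ⟨_, ⟨_, h, hA, rfl⟩,
      (hlec _).2 ⟨_, _, h, h₁, fun z hz => (mem_sep.1 hz).2.1, rfl⟩,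
      (hlec _).2 ⟨_, _, h, h₂, fun z hz => (mem_sep.1 hz).2.2, rfl⟩⟩
  · rintro D hD ⟨-, hdense⟩
    obtain ⟨B, hB, hAB, hBD⟩ := exists_mem_dense (η := η) (c := c) (A := A) (inHOD_iff.1 hD)
      (fun B hB => by
        obtain ⟨q, hq, hle⟩ := hdense _ ((hPc _).2 ⟨B, hB, rfl⟩)
        obtain ⟨B₁, B₂, h₁, h₂, hsub, h⟩ := (hlec _).1 hle
        obtain ⟨rfl, h'⟩ := pair_inj.1 h
        obtain rfl := hcInj _ _ hB h₂ h'
        exact ⟨B₁, h₁, hq, hsub⟩) hAη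
    exact ⟨_, ⟨B, hB, hAB, rfl⟩, hBD⟩
  · have hcodes : Codes (ZFSet.sep (fun p => ∃ B : ZFSet, VCond η B ∧ A ∈ B ∧ p = c B) P)
        {p : ZFSet | ∃ B : ZFSet, VCond η B ∧ A ∈ B ∧ p = c B} := fun p => by
      rw [mem_sep]
      refine ⟨fun h => h.2, fun h => ⟨?_, h⟩⟩
      obtain ⟨B, hB, -, rfl⟩ := h
      exact (hPc _).2 ⟨B, hB, rfl⟩
    exact ⟨_, inHODp_generic (hg_iff hcodes), hcodes⟩
  · rintro N hN hZFC hHOD ⟨g, hgN, hg⟩ x hx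
    have : TransModel N := ⟨hN, hZFC⟩
    exact mem_of_inHODp hAη hPc (fun x hx => hHOD (inHOD_iff.2 hx)) hgN (hg_iff hg) hx
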